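/- Let g be an indecomposable symmetrizable Kac-Moody algebra which is finitely Σ-graded with grading subalgebra m (with Cartan subalgebra a ⊂ h and Σ indecomposable), and suppose the set Δ^im of imaginary roots of g is nonempty. Then there exists a root basis of Σ such that ρ_a(Δ^im_+) ⊂ Σ^im_+, i.e. the restriction to a of every positive imaginary root of Δ is a positive imaginary root of Σ. -/

import Mathlib

attribute [local instance] Classical.propDecidable

noncomputable section

namespace KMG

open Module

/-! ### Generalized Cartan matrices -/

/-- `A` is a generalized Cartan matrix. -/
def IsGCM {I : Type*} (A : Matrix I I ℤ) : Prop :=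
  (∀ i, A i i = 2) ∧ (∀ i j, i ≠ j → A i j ≤ 0) ∧ ∀ i j, A i j = 0 → A j i = 0

/-- `A` is indecomposable. -/
def Indecomposable {I : Type*} (A : Matrix I I ℤ) : Prop :=
  ∀ s : Set I, s.Nonempty → sᶜ.Nonempty → ∃ i ∈ s, ∃ j ∈ sᶜ, A i j ≠ 0

/-- `A` is symmetrizable: `D A` is symmetric for an invertible diagonal matrix `D`. -/
def Symmetrizable {I : Type*} (A : Matrix I I ℤ) : Prop :=
  ∃ d : I → ℚ, (∀ i, d i ≠ 0) ∧ ∀ i j, d i * (A i j : ℚ) = d j * (A j i : ℚ)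

/-- The principal submatrix of `A` indexed by a subset `S`. -/
def restrictM {I : Type*} (A : Matrix I I ℤ) (S : Set I) : Matrix S S ℤ :=
  fun i j => A i.1 j.1

/-- `A` is of finite type: `A u > 0` for some `u > 0` (Kac, Thm. 4.3). -/
def IsFiniteType {I : Type*} (A : Matrix I I ℤ) : Prop :=
  ∃ u : I → ℚ, (∀ i, 0 < u i) ∧ ∀ i, 0 < ∑ᶠ j, (A i j : ℚ) * u j

/-- `A` is of affine type: `A` indecomposable and `A u = 0` for some `u > 0`. -/
def IsAffineType {I : Type*} (A : Matrix I I ℤ) : Prop :=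
  Indecomposable A ∧ ∃ u : I → ℚ, (∀ i, 0 < u i) ∧ ∀ i, ∑ᶠ j, (A i j : ℚ) * u j = 0

/-- `A` is of indefinite type: `A u < 0` for some `u > 0`. -/
def IsIndefiniteType {I : Type*} (A : Matrix I I ℤ) : Prop :=
  ∃ u : I → ℚ, (∀ i, 0 < u i) ∧ ∀ i, ∑ᶠ j, (A i j : ℚ) * u j < 0

/-- The corank of a generalized Cartan matrix. -/
def gcmCorank {I : Type*} [Fintype I] [DecidableEq I] (A : Matrix I I ℤ) : ℕ :=
  Fintype.card I - (A.map ((↑) : ℤ → ℚ)).rank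

/-- The connected component of the vertex `k` in the subdiagram of the Dynkin diagram of `A`
with vertex set `S`. -/
def cmpnt {I : Type*} (A : Matrix I I ℤ) (S : Set I) (k : I) : Set I :=
  {i | i ∈ S ∧ Relation.ReflTransGen (fun x y => x ∈ S ∧ y ∈ S ∧ A x y ≠ 0) k i}

/-- `A` is hyperbolic: deleting any one vertex of the Dynkin diagram leaves a disjoint union
of diagrams of finite or affine type. -/
def IsHyperbolic {I : Type*} (A : Matrix I I ℤ) : Prop :=
  ∀ i₀ k : I, k ≠ i₀ →
    IsFiniteType (restrictM A (cmpnt A {i | i ≠ i₀} k)) ∨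
      IsAffineType (restrictM A (cmpnt A {i | i ≠ i₀} k))

/-- `A` is Lorentzian: `A` is nonsingular and its symmetrization has signature `(+,...,+,-)`. -/
def IsLorentzian {I : Type*} [Fintype I] [DecidableEq I] (A : Matrix I I ℤ) : Prop :=
  IsUnit (A.map ((↑) : ℤ → ℚ)).det ∧
    ∃ d : I → ℚ, (∀ i, 0 < d i) ∧ (∀ i j, d i * (A i j : ℚ) = d j * (A j i : ℚ)) ∧
      ∃ P : Matrix I I ℝ, IsUnit P.det ∧ ∃ i₀ : I,
        P.transpose * (Matrix.of fun i j => ((d i : ℝ) * (A i j : ℝ))) * P =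
          Matrix.diagonal fun i => if i = i₀ then (-1 : ℝ) else 1

/-! ### Weight spaces -/

variable {g : Type*} [LieRing g] [LieAlgebra ℂ g]

/-- The weight space of weight `χ` for the adjoint action on `g` of a space `V` mapping to `g`
by `ι`. -/
def wtSpaceι {V : Type*} [AddCommGroup V] [Module ℂ V] (ι : V →ₗ[ℂ] g)
    (χ : Module.Dual ℂ V) : Submodule ℂ g where
  carrier := {x | ∀ v : V, ⁅ι v, x⁆ = χ v • x}
  add_mem' := fun ha hb v => by rw [lie_add, ha v, hb v, smul_add]
  zero_mem' := fun v => by rw [lie_zero, smul_zero]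
  smul_mem' := fun c x hx v => by rw [lie_smul, hx v, smul_comm]

/-! ### Kac-Moody algebras -/

/-- A (symmetrizable) Kac-Moody algebra structure on the Lie algebra `g`, for the generalized
Cartan matrix `A` indexed by `I` : a realization `(H, root, coroot)` of `A` together with
Chevalley generators `e i`, `f i` satisfying the Chevalley-Serre relations, such that `g` is
generated by `H` and the `e i, f i`, is diagonalizable under `H`, with `0`-weight space `H`. -/
structure KacMoodyAlgebra {I : Type*} [Fintype I] [DecidableEq I] (A : Matrix I I ℤ)
    (g : Type*) [LieRing g] [LieAlgebra ℂ g] : Type _ where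
  H : Submodule ℂ g
  root : I → Module.Dual ℂ H
  coroot : I → H
  e : I → g
  f : I → g
  findimH : FiniteDimensional ℂ H
  finrankH : Module.finrank ℂ H = Fintype.card I + gcmCorank A
  indepRoot : LinearIndependent ℂ root
  indepCoroot : LinearIndependent ℂ coroot
  pairing : ∀ i j, root j (coroot i) = (A i j : ℂ)
  abelian : ∀ x y : H, ⁅(x : g), (y : g)⁆ = 0
  lie_e : ∀ (x : H) (i : I), ⁅(x : g), e i⁆ = root i x • e i
  lie_f : ∀ (x : H) (i : I), ⁅(x : g), f i⁆ = -(root i x) • f i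
  e_f : ∀ i j, ⁅e i, f j⁆ = if j = i then ((coroot i : g)) else 0
  serre_e : ∀ i j, i ≠ j →
    ((LieAlgebra.ad ℂ g (e i)) ^ (1 - A i j).toNat) (e j) = 0
  serre_f : ∀ i j, i ≠ j →
    ((LieAlgebra.ad ℂ g (f i)) ^ (1 - A i j).toNat) (f j) = 0
  generates : LieSubalgebra.lieSpan ℂ g ((H : Set g) ∪ Set.range e ∪ Set.range f) = ⊤
  weight_decomp : ⨆ χ : Module.Dual ℂ H, wtSpaceι H.subtype χ = ⊤
  zero_weight : wtSpaceι H.subtype (0 : Module.Dual ℂ H) = H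

variable {I : Type*} [Fintype I] [DecidableEq I] {A : Matrix I I ℤ}

/-- The root system of a Kac-Moody algebra: nonzero weights of the adjoint action of the
Cartan subalgebra. -/
def Delta (G : KacMoodyAlgebra A g) : Set (Module.Dual ℂ G.H) :=
  {χ | χ ≠ 0 ∧ wtSpaceι G.H.subtype χ ≠ ⊥}

/-- The positive roots with respect to the standard root basis. -/
def posRoots (G : KacMoodyAlgebra A g) : Set (Module.Dual ℂ G.H) :=
  {χ ∈ Delta G | ∃ c : I → ℕ, χ = ∑ i, (c i : ℂ) • G.root i}

/-- The real roots : the orbit of the simple roots under the Weyl group. -/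
inductive IsRealRoot (G : KacMoodyAlgebra A g) : Module.Dual ℂ G.H → Prop
  | simple (i : I) : IsRealRoot G (G.root i)
  | reflect (i : I) (χ : Module.Dual ℂ G.H) :
      IsRealRoot G χ → IsRealRoot G (χ - χ (G.coroot i) • G.root i)

/-- The subalgebra `g(S)` generated by the root spaces `g_{± α_i}`, `i ∈ S`. -/
def gS (G : KacMoodyAlgebra A g) (S : Set I) : LieSubalgebra ℂ g :=
  LieSubalgebra.lieSpan ℂ g ({x | ∃ i ∈ S, x = G.e i} ∪ {x | ∃ i ∈ S, x = G.f i})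

/-- The subspace `h^J = {h ∈ h | ⟨α_j, h⟩ = 0 ∀ j ∈ J}`. -/
def hJsub (G : KacMoodyAlgebra A g) (J : Set I) : Submodule ℂ G.H :=
  ⨅ j ∈ J, LinearMap.ker (G.root j)

/-- `Hk` is the canonical semisimple element attached to `k` and the component `S = I_k` :
it lies in the span of the coroots from `S` and satisfies `⟨α_i, H_k⟩ = 2 δ_{i,k}` on `S`. -/
def IsHGen (G : KacMoodyAlgebra A g) (S : Set I) (k : I) (Hk : G.H) : Prop :=
  Hk ∈ Submodule.span ℂ (G.coroot '' S) ∧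
    ∀ i ∈ S, G.root i Hk = if i = k then 2 else 0

/-- `g(S)` is `A₁`-graded by the `sl₂`-triple with semisimple element `Hk` :
`ad Hk` has only eigenvalues `0, 2, -2` on `g(S)`. -/
def A1GradedBy (G : KacMoodyAlgebra A g) (S : Set I) (Hk : g) : Prop :=
  ∀ x ∈ gS G S, x ∈ Module.End.eigenspace (LieAlgebra.ad ℂ g Hk) 0 ⊔
    Module.End.eigenspace (LieAlgebra.ad ℂ g Hk) 2 ⊔
      Module.End.eigenspace (LieAlgebra.ad ℂ g Hk) (-2)

/-- The pair `(I_k, J_k)` (for `I_k` the connected component of `k` in `J ∪ {k}`) is an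
irreducible `C`-admissible pair. -/
def CAdmissibleComponent (G : KacMoodyAlgebra A g) (J : Set I) (k : I) : Prop :=
  IsFiniteType (restrictM A (cmpnt A (J ∪ {k}) k)) ∧
    ∃ Hk : G.H, IsHGen G (cmpnt A (J ∪ {k}) k) k Hk ∧
      ∃ E F : g, E ∈ gS G (cmpnt A (J ∪ {k}) k) ∧ F ∈ gS G (cmpnt A (J ∪ {k}) k) ∧
        IsSl2Triple (Hk : g) E F ∧ A1GradedBy G (cmpnt A (J ∪ {k}) k) (Hk : g)

/-- The data of a `C`-admissible pair `(I, J)` : for each `k ∉ J`, the component `I_k` is of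
finite type and carries an `sl₂`-triple `(E_k, H_k, F_k)` which `A₁`-grades `g(I_k)`. -/
structure CAdmissibleData (G : KacMoodyAlgebra A g) (J : Set I) : Type _ where
  finJ : IsFiniteType (restrictM A J)
  Hc : {k : I // k ∉ J} → G.H
  E : {k : I // k ∉ J} → g
  F : {k : I // k ∉ J} → g
  finIk : ∀ k : {k : I // k ∉ J}, IsFiniteType (restrictM A (cmpnt A (J ∪ {k.1}) k.1))
  isHGen : ∀ k, IsHGen G (cmpnt A (J ∪ {k.1}) k.1) k.1 (Hc k)
  memE : ∀ k, E k ∈ gS G (cmpnt A (J ∪ {k.1}) k.1)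
  memF : ∀ k, F k ∈ gS G (cmpnt A (J ∪ {k.1}) k.1)
  sl2 : ∀ k, IsSl2Triple ((Hc k : g)) (E k) (F k)
  a1 : ∀ k, A1GradedBy G (cmpnt A (J ∪ {k.1}) k.1) ((Hc k : g))

/-- `(I,J)` is a `C`-admissible pair. -/
def CAdmissiblePair (G : KacMoodyAlgebra A g) (J : Set I) : Prop :=
  Nonempty (CAdmissibleData G J)

/-- The data of a `C`-admissible pair `(Itot, J)` for a subdiagram `Itot ⊆ I`. -/
structure CAdmissibleDataIn (G : KacMoodyAlgebra A g) (Itot J : Set I) : Type _ where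
  subJ : J ⊆ Itot
  finJ : IsFiniteType (restrictM A J)
  Hc : {k : I // k ∈ Itot ∧ k ∉ J} → G.H
  E : {k : I // k ∈ Itot ∧ k ∉ J} → g
  F : {k : I // k ∈ Itot ∧ k ∉ J} → g
  finIk : ∀ k : {k : I // k ∈ Itot ∧ k ∉ J},
    IsFiniteType (restrictM A (cmpnt A (J ∪ {k.1}) k.1))
  isHGen : ∀ k, IsHGen G (cmpnt A (J ∪ {k.1}) k.1) k.1 (Hc k)
  memE : ∀ k, E k ∈ gS G (cmpnt A (J ∪ {k.1}) k.1)
  memF : ∀ k, F k ∈ gS G (cmpnt A (J ∪ {k.1}) k.1)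
  sl2 : ∀ k, IsSl2Triple ((Hc k : g)) (E k) (F k)
  a1 : ∀ k, A1GradedBy G (cmpnt A (J ∪ {k.1}) k.1) ((Hc k : g))

/-- The `C`-admissible subalgebra `g^J` : generated by `h^J` and the `E_k, F_k`. -/
def CAdmissibleData.gJ {G : KacMoodyAlgebra A g} {J : Set I} (D : CAdmissibleData G J) :
    LieSubalgebra ℂ g :=
  LieSubalgebra.lieSpan ℂ g
    ((((hJsub G J).map G.H.subtype : Submodule ℂ g) : Set g) ∪ Set.range D.E ∪ Set.range D.F)

/-- `GJ` is "the" Kac-Moody structure on `g^J` associated to a `C`-admissible pair: its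
Cartan subalgebra is `h^J`, its coroots are the `H_k` and its Chevalley generators are the
`E_k, F_k`; the matrix `A'` is `A^J`, i.e. `a'_{k,l} = ⟨α_l, H_k⟩`. -/
def CAdmissibleData.IsAssocKM {G : KacMoodyAlgebra A g} {J : Set I} (D : CAdmissibleData G J)
    {A' : Matrix {k : I // k ∉ J} {k : I // k ∉ J} ℤ}
    (GJ : KacMoodyAlgebra A' ↥D.gJ) : Prop :=
  (∀ k l, (A' k l : ℂ) = G.root l.1 (D.Hc k)) ∧
  GJ.H.map D.gJ.toSubmodule.subtype = (hJsub G J).map G.H.subtype ∧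
  (∀ k, ((GJ.coroot k : ↥D.gJ) : g) = ((D.Hc k : ↥G.H) : g)) ∧
  (∀ k, ((GJ.e k : ↥D.gJ) : g) = D.E k) ∧ (∀ k, ((GJ.f k : ↥D.gJ) : g) = D.F k)

/-! ### Finite gradations -/

/-- `g` is finitely `Σ`-graded, where `Σ` is the root system of the Kac-Moody algebra `m`
(with Kac-Moody structure `M`) and `m` is embedded in `g` by `φ` (the grading subalgebra is
the image of `φ`): `g` is the sum of the weight spaces `V_γ`, `γ ∈ Σ ∪ {0}`, of the adjoint
action of the Cartan subalgebra of `m`, and each `V_γ` is finite dimensional. -/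
def IsFinGrading {S : Type*} [Fintype S] [DecidableEq S] {B : Matrix S S ℤ}
    {m : Type*} [LieRing m] [LieAlgebra ℂ m] (M : KacMoodyAlgebra B m)
    (φ : m →ₗ⁅ℂ⁆ g) : Prop :=
  Function.Injective φ ∧
  (⨆ χ ∈ insert (0 : Module.Dual ℂ M.H) (Delta M),
      wtSpaceι (φ.toLinearMap ∘ₗ M.H.subtype) χ) = ⊤ ∧
  ∀ χ ∈ insert (0 : Module.Dual ℂ M.H) (Delta M),
      FiniteDimensional ℂ (wtSpaceι (φ.toLinearMap ∘ₗ M.H.subtype) χ)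

section Grading

variable {S : Type*} [Fintype S] [DecidableEq S] {B : Matrix S S ℤ}
variable {m : Type*} [LieRing m] [LieAlgebra ℂ m]

/-- The inclusion of the Cartan subalgebra of the grading subalgebra into the Cartan
subalgebra of `g` (given `a ⊆ h`). -/
def cartanIncl (G : KacMoodyAlgebra A g) (M : KacMoodyAlgebra B m) (φ : m →ₗ⁅ℂ⁆ g)
    (hle : M.H.map φ.toLinearMap ≤ G.H) : M.H →ₗ[ℂ] G.H :=
  LinearMap.codRestrict G.H (φ.toLinearMap ∘ₗ M.H.subtype)
    (fun x => hle (Submodule.mem_map_of_mem x.2))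

/-- The restriction `ρ_a(χ)` to the Cartan subalgebra `a` of `m` of a linear form `χ` on `h`. -/
def resD (G : KacMoodyAlgebra A g) (M : KacMoodyAlgebra B m) (φ : m →ₗ⁅ℂ⁆ g)
    (hle : M.H.map φ.toLinearMap ≤ G.H) (χ : Module.Dual ℂ G.H) : Module.Dual ℂ M.H :=
  χ.comp (cartanIncl G M φ hle)

/-- The restriction `ρ_a(α_i)` of the simple root `α_i` to `a`. -/
def resRoot (G : KacMoodyAlgebra A g) (M : KacMoodyAlgebra B m) (φ : m →ₗ⁅ℂ⁆ g)
    (hle : M.H.map φ.toLinearMap ≤ G.H) (i : I) : Module.Dual ℂ M.H :=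
  resD G M φ hle (G.root i)

/-- The root basis of `M` is adapted to the root basis of `G` :
`ρ_a(Δ⁺) ⊆ Σ⁺ ∪ {0}`. -/
def Adapted (G : KacMoodyAlgebra A g) (M : KacMoodyAlgebra B m) (φ : m →ₗ⁅ℂ⁆ g)
    (hle : M.H.map φ.toLinearMap ≤ G.H) : Prop :=
  ∀ χ ∈ posRoots G, resD G M φ hle χ = 0 ∨ resD G M φ hle χ ∈ posRoots M

/-- The set `J = {i ∈ I | ρ_a(α_i) = 0}`. -/
def Jof (G : KacMoodyAlgebra A g) (M : KacMoodyAlgebra B m) (φ : m →ₗ⁅ℂ⁆ g)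
    (hle : M.H.map φ.toLinearMap ≤ G.H) : Set I :=
  {i | resRoot G M φ hle i = 0}

/-- The set `Γ_s = {i ∈ I' | ρ_a(α_i) = γ_s}`. -/
def GammaOf (G : KacMoodyAlgebra A g) (M : KacMoodyAlgebra B m) (φ : m →ₗ⁅ℂ⁆ g)
    (hle : M.H.map φ.toLinearMap ≤ G.H) (s : S) : Set I :=
  {i | resRoot G M φ hle i = M.root s}

/-- The set `I'_re = {i ∈ I' | ρ_a(α_i) ∈ Π_a}`. -/
def IpRe (G : KacMoodyAlgebra A g) (M : KacMoodyAlgebra B m) (φ : m →ₗ⁅ℂ⁆ g)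
    (hle : M.H.map φ.toLinearMap ≤ G.H) : Set I :=
  {i | ∃ s : S, resRoot G M φ hle i = M.root s}

/-- The set `I'_im = {i ∈ I | ρ_a(α_i) ∉ Π_a ∪ {0}}`. -/
def IpIm (G : KacMoodyAlgebra A g) (M : KacMoodyAlgebra B m) (φ : m →ₗ⁅ℂ⁆ g)
    (hle : M.H.map φ.toLinearMap ≤ G.H) : Set I :=
  {i | resRoot G M φ hle i ≠ 0 ∧ ∀ s : S, resRoot G M φ hle i ≠ M.root s}

/-- The set `I_re` : union of the components `I_k`, `k ∈ I'_re`. -/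
def IreOf (G : KacMoodyAlgebra A g) (M : KacMoodyAlgebra B m) (φ : m →ₗ⁅ℂ⁆ g)
    (hle : M.H.map φ.toLinearMap ≤ G.H) : Set I :=
  {i | ∃ k ∈ IpRe G M φ hle, i ∈ cmpnt A (Jof G M φ hle ∪ {k}) k}

/-- `g` is maximally finitely graded: finitely graded, with `a ⊆ h`, the root basis of the
grading subalgebra adapted, and the corresponding sets `J` and `I'_im` empty. -/
def MaxFinGrading (G : KacMoodyAlgebra A g) (M : KacMoodyAlgebra B m) (φ : m →ₗ⁅ℂ⁆ g) : Prop :=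
  IsFinGrading M φ ∧ ∃ hle : M.H.map φ.toLinearMap ≤ G.H,
    Adapted G M φ hle ∧ Jof G M φ hle = ∅ ∧ IpIm G M φ hle = ∅

end Grading

/-- `(π, πv)` is a root basis (with generalized Cartan matrix `B`) of the root system `Rts`. -/
def IsRootBasis {V : Type*} [AddCommGroup V] [Module ℂ V] {S : Type*} [Fintype S]
    (B : Matrix S S ℤ) (Rts : Set (Module.Dual ℂ V)) (π : S → Module.Dual ℂ V)
    (πv : S → V) : Prop :=
  LinearIndependent ℂ π ∧ LinearIndependent ℂ πv ∧
  (∀ s t, π t (πv s) = (B s t : ℂ)) ∧ (∀ s, π s ∈ Rts) ∧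
  ∀ χ ∈ Rts, (∃ c : S → ℕ, χ = ∑ s, (c s : ℂ) • π s) ∨
    (∃ c : S → ℕ, χ = -∑ s, (c s : ℂ) • π s)

/-- `Bf` is a nondegenerate invariant symmetric bilinear form on `g`. -/
def InvariantForm (Bf : g →ₗ[ℂ] g →ₗ[ℂ] ℂ) : Prop :=
  (∀ x y, Bf x y = Bf y x) ∧ (∀ x y z, Bf ⁅x, y⁆ z = Bf x ⁅y, z⁆) ∧
  ∀ x, (∀ y, Bf x y = 0) → x = 0

/-- `Bf` is "the" invariant bilinear form of the Kac-Moody algebra `G` : nondegenerate,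
invariant, symmetric, with `(α_i∨, α_i∨)` a positive rational for all `i`. -/
def NormalizedInvForm (G : KacMoodyAlgebra A g) (Bf : g →ₗ[ℂ] g →ₗ[ℂ] ℂ) : Prop :=
  InvariantForm Bf ∧ ∀ i : I, ∃ q : ℚ, 0 < q ∧ Bf ((G.coroot i : g)) ((G.coroot i : g)) = (q : ℂ)

/-- `(e', f')` is a system of Chevalley generators for `G` (with the given Cartan subalgebra,
simple roots and coroots). -/
def IsChevalleyGens (G : KacMoodyAlgebra A g) (e' f' : I → g) : Prop :=
  (∀ (x : G.H) (i : I), ⁅(x : g), e' i⁆ = G.root i x • e' i) ∧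
  (∀ (x : G.H) (i : I), ⁅(x : g), f' i⁆ = -(G.root i x) • f' i) ∧
  (∀ i j, ⁅e' i, f' j⁆ = if j = i then ((G.coroot i : g)) else 0) ∧
  (∀ i j, i ≠ j → ((LieAlgebra.ad ℂ g (e' i)) ^ (1 - A i j).toNat) (e' j) = 0) ∧
  (∀ i j, i ≠ j → ((LieAlgebra.ad ℂ g (f' i)) ^ (1 - A i j).toNat) (f' j) = 0) ∧
  LieSubalgebra.lieSpan ℂ g ((G.H : Set g) ∪ Set.range e' ∪ Set.range f') = ⊤


/-- The subalgebra `g(I_re)` of `g` generated by `h_{I_re}` and the `e_i, f_i`, `i ∈ I_re`. -/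
def gIre (G : KacMoodyAlgebra A g) (Ire : Set I) (hIre : Submodule ℂ g) : LieSubalgebra ℂ g :=
  LieSubalgebra.lieSpan ℂ g
    ((hIre : Set g) ∪ {x | ∃ i ∈ Ire, x = G.e i} ∪ {x | ∃ i ∈ Ire, x = G.f i})

/-- `GI` is "the" Kac-Moody structure on `g(I_re)` : its Cartan subalgebra is `h_{I_re}`,
its coroots and Chevalley generators are the `α_i∨, e_i, f_i` of `g`, for `i ∈ I_re`. -/
def IsAssocKMIre (G : KacMoodyAlgebra A g) (Ire : Set I) (hIre : Submodule ℂ g)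
    {A'' : Matrix ↥Ire ↥Ire ℤ} (GI : KacMoodyAlgebra A'' ↥(gIre G Ire hIre)) : Prop :=
  GI.H.map (gIre G Ire hIre).toSubmodule.subtype = hIre ∧
  (∀ i, ((GI.coroot i : ↥(gIre G Ire hIre)) : g) = ((G.coroot i.1 : ↥G.H) : g)) ∧
  (∀ i, ((GI.e i : ↥(gIre G Ire hIre)) : g) = G.e i.1) ∧
  (∀ i, ((GI.f i : ↥(gIre G Ire hIre)) : g) = G.f i.1)

/-! ### Admissible quotients and maximal gradations -/

/-- `ρ : I → S` is an admissible quotient map for `A` : fibers are totally disconnected (MG1)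
and the column sums over a fiber are constant along fibers (MG2). -/
def AdmissibleQuotient {I S : Type*} (A : Matrix I I ℤ) (ρ : I → S) : Prop :=
  Function.Surjective ρ ∧
  (∀ k l, k ≠ l → ρ k = ρ l → A k l = 0) ∧
  ∀ s t : S, s ≠ t → ∀ j j', ρ j = t → ρ j' = t →
    ∑ᶠ i ∈ {i | ρ i = s}, A i j = ∑ᶠ i ∈ {i | ρ i = s}, A i j'

section Quotient

variable {S : Type*} [Fintype S] [DecidableEq S]

/-- `γ_s∨ = ∑_{k ∈ Γ_s} α_k∨`. -/
def gammaV (G : KacMoodyAlgebra A g) (ρ : I → S) (s : S) : G.H :=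
  ∑ᶠ k ∈ {k | ρ k = s}, G.coroot k

/-- `X̄_s = ∑_{k ∈ Γ_s} e_k`. -/
def Xbar (G : KacMoodyAlgebra A g) (ρ : I → S) (s : S) : g :=
  ∑ᶠ k ∈ {k | ρ k = s}, G.e k

/-- `Ȳ_s = ∑_{k ∈ Γ_s} f_k`. -/
def Ybar (G : KacMoodyAlgebra A g) (ρ : I → S) (s : S) : g :=
  ∑ᶠ k ∈ {k | ρ k = s}, G.f k

/-- The subalgebra `g^ρ` generated by `a` and the `X̄_s, Ȳ_s`. -/
def gRho (G : KacMoodyAlgebra A g) (ρ : I → S) (a : Submodule ℂ G.H) : LieSubalgebra ℂ g :=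
  LieSubalgebra.lieSpan ℂ g
    (((a.map G.H.subtype : Submodule ℂ g) : Set g) ∪ Set.range (Xbar G ρ) ∪
      Set.range (Ybar G ρ))

/-- `Gρ` is "the" Kac-Moody structure on `g^ρ` : its Cartan subalgebra is `a`, its coroots
are the `γ_s∨` and its Chevalley generators are the `X̄_s, Ȳ_s`. -/
def IsAssocKMrho (G : KacMoodyAlgebra A g) (ρ : I → S) (a : Submodule ℂ G.H)
    {Abar : Matrix S S ℤ} (Gρ : KacMoodyAlgebra Abar ↥(gRho G ρ a)) : Prop :=
  Gρ.H.map (gRho G ρ a).toSubmodule.subtype = a.map G.H.subtype ∧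
  (∀ s, ((Gρ.coroot s : ↥(gRho G ρ a)) : g) = ((gammaV G ρ s : ↥G.H) : g)) ∧
  (∀ s, ((Gρ.e s : ↥(gRho G ρ a)) : g) = Xbar G ρ s) ∧
  (∀ s, ((Gρ.f s : ↥(gRho G ρ a)) : g) = Ybar G ρ s)

end Quotient

end KMG

namespace KMG

/-! ### Abstract sets of roots -/

section RootSets

variable {I : Type*} [Fintype I] [DecidableEq I]

/-- The action of the simple reflection `s_i` on the root lattice. -/
def simpleRefl (A : Matrix I I ℤ) (i : I) : (I → ℤ) →ₗ[ℤ] (I → ℤ) :=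
  LinearMap.id - LinearMap.single ℤ (fun _ : I => ℤ) i ∘ₗ LinearMap.proj i ∘ₗ A.mulVecLin

/-- The support of `c` is connected in the Dynkin diagram of `A`. -/
def SuppConnected (A : Matrix I I ℤ) (c : I → ℤ) : Prop :=
  ∀ X : Set I, (∃ i ∈ X, c i ≠ 0) → (∃ j ∉ X, c j ≠ 0) →
    ∃ i ∈ X, ∃ j ∉ X, c i ≠ 0 ∧ c j ≠ 0 ∧ A i j ≠ 0

/-- The properties of the root system of a Kac-Moody algebra, as a subset of the root lattice,
from which the existence and the linkage of imaginary roots follow. -/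
structure IsRootSet (A : Matrix I I ℤ) (R : Set (I → ℤ)) : Prop where
  zero_notMem : 0 ∉ R
  nonneg_or_nonpos : ∀ c ∈ R, 0 ≤ c ∨ c ≤ 0
  single_mem : ∀ i, Pi.single i 1 ∈ R
  simpleRefl_mem : ∀ i, ∀ c ∈ R, simpleRefl A i c ∈ R
  add_single_mem : ∀ i, ∀ c ∈ R, A.mulVec c i < 0 → c + Pi.single i 1 ≠ 0 →
    c + Pi.single i 1 ∈ R
  eq_single : ∀ i, ∀ c ∈ R, 0 ≤ c → (∀ j, j ≠ i → c j = 0) → c = Pi.single i 1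
  suppConnected : ∀ c ∈ R, 0 ≤ c → SuppConnected A c

variable {A : Matrix I I ℤ}

lemma simpleRefl_apply (i : I) (c : I → ℤ) :
    simpleRefl A i c = c - Pi.single i (A.mulVec c i) := rfl

lemma mulVec_simpleRefl (i j : I) (c : I → ℤ) :
    A.mulVec (simpleRefl A i c) j = A.mulVec c j - A j i * A.mulVec c i := by
  rw [simpleRefl_apply, Matrix.mulVec_sub, Pi.sub_apply, Matrix.mulVec_single]
  simp

lemma simpleRefl_simpleRefl (hA : IsGCM A) (i : I) (c : I → ℤ) :
    simpleRefl A i (simpleRefl A i c) = c := by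
  rw [simpleRefl_apply i (simpleRefl A i c), mulVec_simpleRefl, hA.1 i, simpleRefl_apply]
  ext j
  by_cases h : j = i
  · subst h; simp; ring
  · simp [h]

end RootSets

end KMG

namespace KMG

open Module

/-! ### Weight spaces and `sl₂`-triples -/

section WeightSpaces

variable {g : Type*} [LieRing g] [LieAlgebra ℂ g] {V : Type*} [AddCommGroup V] [Module ℂ V]
  {ι : V →ₗ[ℂ] g}

lemma lie_mem_wtSpaceι {χ ψ : Module.Dual ℂ V} {x y : g} (hx : x ∈ wtSpaceι ι χ)
    (hy : y ∈ wtSpaceι ι ψ) : ⁅x, y⁆ ∈ wtSpaceι ι (χ + ψ) := fun v => by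
  rw [leibniz_lie, hx v, hy v, smul_lie, lie_smul, LinearMap.add_apply, add_smul]

lemma ad_pow_mem_wtSpaceι {χ ψ : Module.Dual ℂ V} {x y : g} (hx : x ∈ wtSpaceι ι χ)
    (hy : y ∈ wtSpaceι ι ψ) (n : ℕ) :
    (LieAlgebra.ad ℂ g x ^ n) y ∈ wtSpaceι ι (ψ + (n : ℂ) • χ) := by
  induction n with
  | zero => simpa using hy
  | succ n ih =>
    rw [pow_succ', Module.End.mul_apply, LieAlgebra.ad_apply]
    have h := lie_mem_wtSpaceι hx ih
    rwa [show χ + (ψ + (n : ℂ) • χ) = ψ + ((n + 1 : ℕ) : ℂ) • χ by push_cast; module] at h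

lemma iSupIndep_wtSpaceι (hc : ∀ v w, ⁅ι v, ι w⁆ = 0) : iSupIndep (wtSpaceι ι) := by
  have h := Module.End.independent_iInf_maxGenEigenspace_of_forall_mapsTo
    (fun v : V => LieAlgebra.ad ℂ g (ι v)) fun v w μ =>
      Module.End.mapsTo_maxGenEigenspace_of_comm (f := LieAlgebra.ad ℂ g (ι w))
        (g := LieAlgebra.ad ℂ g (ι v)) (by
          ext x
          simp only [Module.End.mul_apply, LieAlgebra.ad_apply]
          rw [leibniz_lie, hc, zero_lie, zero_add]) μ
  refine (h.comp (f := fun χ : Module.Dual ℂ V => (χ : V → ℂ)) DFunLike.coe_injective).mono ?_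
  intro χ x hx
  simp only [Function.comp_apply, Submodule.mem_iInf]
  intro v
  refine (Module.End.mem_maxGenEigenspace _ _ _).2 ⟨1, ?_⟩
  simp [hx v]

lemma mem_of_mem_wtSpaceι (hc : ∀ v w, ⁅ι v, ι w⁆ = 0) {X : Set (Module.Dual ℂ V)}
    {χ : Module.Dual ℂ V} {x : g} (hx : x ∈ wtSpaceι ι χ) (hx0 : x ≠ 0)
    (hX : x ∈ ⨆ ψ ∈ X, wtSpaceι ι ψ) : χ ∈ X := by
  by_contra h
  exact hx0 ((Submodule.disjoint_def.1 ((iSupIndep_wtSpaceι hc).disjoint_biSup h)) x hx hX)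

/-- In an `sl₂`-module on which `f` acts locally nilpotently, `e ^ k` is injective on the weight
space of weight `-k`. -/
lemma ad_pow_ne_zero {h e f x : g} (t : IsSl2Triple h e f) {k : ℕ} (hx0 : x ≠ 0)
    (hx : ⁅h, x⁆ = (-(k : ℂ)) • x) (hf : ∃ n, (LieAlgebra.ad ℂ g f ^ n) x = 0) :
    (LieAlgebra.ad ℂ g e ^ k) x ≠ 0 := by
  intro hk
  have hwt : ∀ b : ℕ, ⁅h, (LieAlgebra.ad ℂ g f ^ b) x⁆ =
      (-((k : ℂ) + 2 * b)) • (LieAlgebra.ad ℂ g f ^ b) x := by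
    intro b
    induction b with
    | zero => simpa using hx
    | succ b ih =>
      rw [pow_succ', Module.End.mul_apply, LieAlgebra.ad_apply, leibniz_lie, ih,
        t.lie_lie_smul_f ℂ, lie_smul, neg_lie, smul_lie]
      push_cast
      module
  have hwe : ∀ (y : g) (c : ℂ) (n : ℕ), ⁅h, y⁆ = c • y →
      ⁅h, (LieAlgebra.ad ℂ g e ^ n) y⁆ = (c + 2 * n) • (LieAlgebra.ad ℂ g e ^ n) y := by
    intro y c n hy
    induction n with
    | zero => simpa using hy
    | succ n ih =>
      rw [pow_succ', Module.End.mul_apply, LieAlgebra.ad_apply, leibniz_lie, ih,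
        t.lie_h_e_smul ℂ, lie_smul, smul_lie]
      push_cast
      module
  have hcomm : ∀ (y : g) (c : ℂ) (n : ℕ), ⁅h, y⁆ = c • y → (LieAlgebra.ad ℂ g e ^ n) y = 0 →
      (LieAlgebra.ad ℂ g e ^ (n + 1)) ⁅f, y⁆ = 0 := by
    intro y c n hy hn
    have key : ∀ l : ℕ, ∃ d : ℂ, (LieAlgebra.ad ℂ g e ^ (l + 1)) ⁅f, y⁆ =
        ⁅f, (LieAlgebra.ad ℂ g e ^ (l + 1)) y⁆ + d • (LieAlgebra.ad ℂ g e ^ l) y := by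
      intro l
      induction l with
      | zero =>
        refine ⟨c, ?_⟩
        simp only [zero_add, pow_one, pow_zero, LieAlgebra.ad_apply, Module.End.one_apply]
        rw [leibniz_lie, t.lie_e_f, hy, add_comm]
      | succ l ih =>
        obtain ⟨d, hd⟩ := ih
        refine ⟨d + (c + 2 * (l + 1 : ℕ)), ?_⟩
        rw [pow_succ' _ (l + 1), Module.End.mul_apply, hd, map_add, LieAlgebra.ad_apply, leibniz_lie,
          t.lie_e_f, hwe y c (l + 1) hy, map_smul,
          show LieAlgebra.ad ℂ g e ((LieAlgebra.ad ℂ g e ^ l) y) =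
            (LieAlgebra.ad ℂ g e ^ (l + 1)) y by rw [pow_succ', Module.End.mul_apply]]
        simp only [Module.End.mul_apply, LieAlgebra.ad_apply]
        module
    obtain ⟨d, hd⟩ := key n
    rw [hd, hn, pow_succ', Module.End.mul_apply, hn]
    simp
  have hkill : ∀ b : ℕ, (LieAlgebra.ad ℂ g e ^ (k + b)) ((LieAlgebra.ad ℂ g f ^ b) x) = 0 := by
    intro b
    induction b with
    | zero => simpa using hk
    | succ b ih =>
      rw [pow_succ' _ b, Module.End.mul_apply, LieAlgebra.ad_apply]
      exact hcomm _ _ _ (hwt b) ih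
  obtain ⟨N, hN, hN1⟩ := Nat.exists_not_and_succ_of_not_zero_of_exists
    (p := fun n => (LieAlgebra.ad ℂ g f ^ n) x = 0) (by simpa using hx0) hf
  have P : t.symm.HasPrimitiveVectorWith ((LieAlgebra.ad ℂ g f ^ N) x) ((k : ℂ) + 2 * N) :=
    ⟨hN, by rw [neg_lie, hwt]; module, by
      rwa [pow_succ', Module.End.mul_apply, LieAlgebra.ad_apply] at hN1⟩
  exact P.pow_toEnd_f_ne_zero_of_eq_nat (n := k + 2 * N) (by push_cast; ring)
    (i := k + N) (by omega) (hkill N)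

end WeightSpaces

end KMG

namespace KMG

open Module

/-! ### The root system of a Kac-Moody algebra -/

section Brackets

variable {g : Type*} [LieRing g] {I : Type*} [DecidableEq I]

/-- The iterated bracket `[u i₁, [u i₂, … [u iₙ, u j]]]`. -/
def iterBracket (u : I → g) (j : I) : List I → g
  | [] => u j
  | i :: l => ⁅u i, iterBracket u j l⁆

/-- The weight, in the root lattice, of `iterBracket u j l`. -/
def iterWeight (j : I) : List I → I → ℤ
  | [] => Pi.single j 1
  | i :: l => Pi.single i 1 + iterWeight j l

lemma iterWeight_nonneg (j : I) (l : List I) : 0 ≤ iterWeight j l := by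
  induction l with
  | nil => exact Pi.single_nonneg.2 zero_le_one
  | cons i l ih => exact add_nonneg (Pi.single_nonneg.2 zero_le_one) ih

lemma iterWeight_self_pos (j : I) (l : List I) : 0 < iterWeight j l j := by
  induction l with
  | nil => simp [iterWeight]
  | cons i l ih =>
    have h : (0 : I → ℤ) ≤ Pi.single i 1 := Pi.single_nonneg.2 zero_le_one
    exact add_pos_of_nonneg_of_pos (h j) ih

lemma lie_iterBracket_eq_zero {u : I → g} {i j : I} {l : List I}
    (h : ∀ k, iterWeight j l k ≠ 0 → ⁅u i, u k⁆ = 0) : ⁅u i, iterBracket u j l⁆ = 0 := by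
  induction l with
  | nil => exact h j (by simp [iterWeight])
  | cons k l ih =>
    have h1 : (0 : I → ℤ) ≤ Pi.single k 1 := Pi.single_nonneg.2 zero_le_one
    have h2 := iterWeight_nonneg j l
    rw [iterBracket, leibniz_lie, h k, ih, zero_lie, lie_zero, add_zero]
    · intro k' hk'
      refine h k' (ne_of_gt ?_)
      exact add_pos_of_nonneg_of_pos (h1 k') (lt_of_le_of_ne (h2 k') (Ne.symm hk'))
    · refine ne_of_gt (add_pos_of_pos_of_nonneg (by simp) (h2 k))

lemma iterWeight_eq_single {u : I → g} {i j : I} {l : List I} (hu : iterBracket u j l ≠ 0)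
    (h : ∀ k, k ≠ i → iterWeight j l k = 0) : iterWeight j l = Pi.single i 1 := by
  have hj : j = i := by
    by_contra hji
    exact (iterWeight_self_pos j l).ne' (h j hji)
  subst hj
  cases l with
  | nil => rfl
  | cons k l =>
    refine absurd (lie_iterBracket_eq_zero fun k' hk' => ?_) hu
    have h1 : (0 : I → ℤ) ≤ Pi.single k 1 := Pi.single_nonneg.2 zero_le_one
    have h2 := iterWeight_nonneg j l
    have hk : k = j := by
      by_contra hkj
      refine (add_pos_of_pos_of_nonneg (?_ : 0 < (Pi.single k 1 : I → ℤ) k) (h2 k)).ne' (h k hkj)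
      simp
    have hk'j : k' = j := by
      by_contra hkj
      exact (add_pos_of_nonneg_of_pos (h1 k') (lt_of_le_of_ne (h2 k') (Ne.symm hk'))).ne'
        (h k' hkj)
    rw [hk, hk'j, lie_self]

lemma suppConnected_iterWeight [Fintype I] {A : Matrix I I ℤ} (hA : IsGCM A) {u : I → g}
    (hu : ∀ i j, A i j = 0 → ⁅u i, u j⁆ = 0) {j : I} {l : List I} (h0 : iterBracket u j l ≠ 0) :
    SuppConnected A (iterWeight j l) := by
  induction l with
  | nil =>
    rintro X ⟨i, hi, hi0⟩ ⟨k, hk, hk0⟩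
    simp only [iterWeight, ne_eq, Pi.single_apply, ite_eq_right_iff, one_ne_zero, imp_false,
      not_not] at hi0 hk0
    exact absurd (hi0 ▸ hi) (hk0 ▸ hk)
  | cons k l ih =>
    have h1 : (0 : I → ℤ) ≤ Pi.single k 1 := Pi.single_nonneg.2 zero_le_one
    have h2 := iterWeight_nonneg j l
    have hl : iterBracket u j l ≠ 0 := fun h => h0 (by rw [iterBracket, h, lie_zero])
    have hk : iterWeight j (k :: l) k ≠ 0 :=
      (add_pos_of_pos_of_nonneg (by simp : 0 < (Pi.single k 1 : I → ℤ) k) (h2 k)).ne'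
    have hsub : ∀ i, iterWeight j l i ≠ 0 → iterWeight j (k :: l) i ≠ 0 := fun i hi =>
      (add_pos_of_nonneg_of_pos (h1 i) (lt_of_le_of_ne (h2 i) (Ne.symm hi))).ne'
    have hsup : ∀ i, iterWeight j (k :: l) i ≠ 0 → i = k ∨ iterWeight j l i ≠ 0 := by
      intro i hi
      by_contra! h
      exact hi (by simp [iterWeight, h.1, h.2])
    obtain ⟨k', hk', hA'⟩ : ∃ k', iterWeight j l k' ≠ 0 ∧ A k k' ≠ 0 := by
      by_contra! h
      exact h0 (lie_iterBracket_eq_zero fun k' hk' => hu _ _ (h k' hk'))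
    intro X hX hX'
    by_cases hin : ∃ i ∈ X, iterWeight j l i ≠ 0
    · by_cases hout : ∃ i ∉ X, iterWeight j l i ≠ 0
      · obtain ⟨a, ha, b, hb, h⟩ := ih hl X hin hout
        exact ⟨a, ha, b, hb, hsub a h.1, hsub b h.2.1, h.2.2⟩
      · push Not at hout
        obtain ⟨b, hb, hb0⟩ := hX'
        have hbk : b = k := (hsup b hb0).resolve_right fun h => h (hout b hb)
        subst hbk
        have hk'X : k' ∈ X := by
          by_contra h
          exact hk' (hout k' h)
        exact ⟨k', hk'X, b, hb, hsub _ hk', hk, fun h => hA' (hA.2.2 _ _ h)⟩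
    · push Not at hin
      obtain ⟨a, ha, ha0⟩ := hX
      have hak : a = k := (hsup a ha0).resolve_right fun h => h (hin a ha)
      subst hak
      exact ⟨a, ha, k', fun h => hk' (hin k' h), hk, hsub _ hk', hA'⟩

end Brackets

section Roots

variable {g : Type*} [LieRing g] [LieAlgebra ℂ g]

lemma lieSpan_le_of_lie_mem {s : Set g} {Z : Submodule ℂ g} (hs : s ⊆ Z)
    (hst : ∀ x ∈ s, ∀ z ∈ Z, ⁅x, z⁆ ∈ Z) {x : g} (hx : x ∈ LieSubalgebra.lieSpan ℂ g s) :
    x ∈ Z := by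
  suffices x ∈ Z ∧ ∀ z ∈ Z, ⁅x, z⁆ ∈ Z from this.1
  induction hx using LieSubalgebra.lieSpan_induction with
  | mem x hx => exact ⟨hs hx, hst x hx⟩
  | zero => exact ⟨Z.zero_mem, fun z _ => by simp⟩
  | add x y _ _ hx hy =>
    exact ⟨Z.add_mem hx.1 hy.1, fun z hz => by
      rw [add_lie]; exact Z.add_mem (hx.2 z hz) (hy.2 z hz)⟩
  | smul a x _ hx =>
    exact ⟨Z.smul_mem a hx.1, fun z hz => by rw [smul_lie]; exact Z.smul_mem a (hx.2 z hz)⟩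
  | lie x y _ _ hx hy =>
    exact ⟨hx.2 y hy.1, fun z hz => by
      rw [lie_lie]; exact Z.sub_mem (hx.2 _ (hy.2 z hz)) (hy.2 _ (hx.2 z hz))⟩

section Span

variable {I : Type*}

/-- The span of the iterated brackets of the `u i`. -/
def iterSpan (u : I → g) : Submodule ℂ g :=
  Submodule.span ℂ (Set.range fun p : I × List I => iterBracket u p.1 p.2)

lemma lie_mem_iterSpan {u : I → g} (i : I) {z : g} (hz : z ∈ iterSpan u) :
    ⁅u i, z⁆ ∈ iterSpan u := by
  induction hz using Submodule.span_induction with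
  | mem z hz =>
    obtain ⟨p, rfl⟩ := hz
    exact Submodule.subset_span ⟨(p.1, i :: p.2), rfl⟩
  | zero => simp
  | add x y _ _ hx hy => rw [lie_add]; exact add_mem hx hy
  | smul a x _ hx => rw [lie_smul]; exact Submodule.smul_mem _ a hx

lemma mem_iterSpan (u : I → g) (i : I) : u i ∈ iterSpan u :=
  Submodule.subset_span ⟨(i, []), rfl⟩

lemma lie_cartan_mem_iterSpan {H : Submodule ℂ g} {u : I → g}
    (hu : ∀ x ∈ H, ∀ i, ∃ a : ℂ, ⁅x, u i⁆ = a • u i) {x z : g} (hx : x ∈ H)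
    (hz : z ∈ iterSpan u) : ⁅x, z⁆ ∈ iterSpan u := by
  induction hz using Submodule.span_induction with
  | mem z hz =>
    obtain ⟨⟨j, l⟩, rfl⟩ := hz
    induction l with
    | nil =>
      obtain ⟨a, ha⟩ := hu x hx j
      change ⁅x, u j⁆ ∈ _
      rw [ha]
      exact Submodule.smul_mem _ a (mem_iterSpan u j)
    | cons i l ih =>
      obtain ⟨a, ha⟩ := hu x hx i
      change ⁅x, ⁅u i, iterBracket u j l⁆⁆ ∈ _
      rw [leibniz_lie, ha, smul_lie]
      exact add_mem (Submodule.smul_mem _ a (Submodule.subset_span ⟨(j, i :: l), rfl⟩))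
        (lie_mem_iterSpan i ih)
  | zero => simp
  | add x y _ _ hx hy => rw [lie_add]; exact add_mem hx hy
  | smul a x _ hx => rw [lie_smul]; exact Submodule.smul_mem _ a hx

lemma lie_mem_iterSpan_sup {H : Submodule ℂ g} {u w : I → g}
    (hw : ∀ x ∈ H, ∀ i, ∃ a : ℂ, ⁅x, w i⁆ = a • w i) (huw : ∀ i j, ⁅u i, w j⁆ ∈ H)
    (i : I) {z : g} (hz : z ∈ iterSpan w) : ⁅u i, z⁆ ∈ H ⊔ iterSpan w := by
  induction hz using Submodule.span_induction with
  | mem z hz =>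
    obtain ⟨⟨j, l⟩, rfl⟩ := hz
    induction l with
    | nil => exact Submodule.mem_sup_left (huw i j)
    | cons k l ih =>
      change ⁅u i, ⁅w k, iterBracket w j l⁆⁆ ∈ _
      rw [leibniz_lie]
      refine add_mem (Submodule.mem_sup_right (lie_cartan_mem_iterSpan hw (huw i k)
        (Submodule.subset_span ⟨(j, l), rfl⟩))) ?_
      obtain ⟨y, hy, z, hz, hyz⟩ := Submodule.mem_sup.1 ih
      change y + z = ⁅u i, iterBracket w j l⁆ at hyz
      rw [← hyz, lie_add]
      refine Submodule.mem_sup_right (add_mem ?_ (lie_mem_iterSpan k hz))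
      obtain ⟨a, ha⟩ := hw y hy k
      rw [← lie_skew, ha]
      exact neg_mem (Submodule.smul_mem _ a (mem_iterSpan w k))
  | zero => simp
  | add x y _ _ hx hy => rw [lie_add]; exact add_mem hx hy
  | smul a x _ hx => rw [lie_smul]; exact Submodule.smul_mem _ a hx

end Span

variable {I : Type*} [Fintype I] [DecidableEq I] {A : Matrix I I ℤ}

/-- The element of the root lattice with given coordinates. -/
def rootComb (G : KacMoodyAlgebra A g) : (I → ℤ) →+ Module.Dual ℂ G.H :=
  AddMonoidHom.mk' (fun c => ∑ i, (c i : ℂ) • G.root i) fun c c' => by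
    simp [add_smul, Finset.sum_add_distrib]

variable (G : KacMoodyAlgebra A g)

lemma rootComb_apply (c : I → ℤ) : rootComb G c = ∑ i, (c i : ℂ) • G.root i := rfl

@[simp] lemma rootComb_single (i : I) (n : ℤ) :
    rootComb G (Pi.single i n) = (n : ℂ) • G.root i := by
  rw [rootComb_apply, Finset.sum_eq_single i]
  · simp
  · intro j _ hj; simp [hj]
  · simp

lemma rootComb_injective : Function.Injective (rootComb G) := by
  refine (injective_iff_map_eq_zero _).2 fun c hc => funext fun i => ?_
  exact_mod_cast Fintype.linearIndependent_iff.1 G.indepRoot _ hc i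

lemma rootComb_coroot (c : I → ℤ) (i : I) :
    rootComb G c (G.coroot i) = (A.mulVec c i : ℂ) := by
  simp [rootComb_apply, Matrix.mulVec, dotProduct, G.pairing, mul_comm]

lemma rootComb_simpleRefl (c : I → ℤ) (i : I) :
    rootComb G (simpleRefl A i c) =
      rootComb G c - rootComb G c (G.coroot i) • G.root i := by
  rw [simpleRefl_apply, map_sub, rootComb_single, rootComb_coroot]

lemma coroot_ne_zero (i : I) : (G.coroot i : g) ≠ 0 := fun h =>
  G.indepCoroot.ne_zero i (Subtype.ext h)

lemma e_mem_wtSpaceι (i : I) : G.e i ∈ wtSpaceι G.H.subtype (G.root i) :=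
  fun v => G.lie_e v i

lemma f_mem_wtSpaceι (i : I) : G.f i ∈ wtSpaceι G.H.subtype (-G.root i) :=
  fun v => G.lie_f v i

lemma isSl2Triple (hA : IsGCM A) (i : I) : IsSl2Triple (G.coroot i : g) (G.e i) (G.f i) where
  h_ne_zero := coroot_ne_zero G i
  lie_e_f := by rw [G.e_f, if_pos rfl]
  lie_h_e_nsmul := by
    rw [G.lie_e, G.pairing, hA.1 i]
    push_cast
    module
  lie_h_f_nsmul := by
    rw [G.lie_f, G.pairing, hA.1 i]
    push_cast
    module

lemma lie_e_e_eq_zero {i j : I} (h : A i j = 0) : ⁅G.e i, G.e j⁆ = 0 := by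
  by_cases hij : i = j
  · rw [hij, lie_self]
  · simpa [h] using G.serre_e i j hij

lemma iterBracket_e_mem (j : I) (l : List I) : iterBracket G.e j l ∈
    wtSpaceι G.H.subtype (rootComb G (iterWeight j l)) := by
  induction l with
  | nil => simpa [iterWeight, iterBracket] using e_mem_wtSpaceι G j
  | cons i l ih => simpa [iterWeight, iterBracket] using lie_mem_wtSpaceι (e_mem_wtSpaceι G i) ih

lemma iterBracket_f_mem (j : I) (l : List I) : iterBracket G.f j l ∈
    wtSpaceι G.H.subtype (-rootComb G (iterWeight j l)) := by
  induction l with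
  | nil => simpa [iterWeight, iterBracket] using f_mem_wtSpaceι G j
  | cons i l ih =>
    have h := lie_mem_wtSpaceι (f_mem_wtSpaceι G i) ih
    rw [← neg_add] at h
    simpa [iterWeight, iterBracket] using h

lemma lie_cartan_e {x : g} (hx : x ∈ G.H) (i : I) : ∃ a : ℂ, ⁅x, G.e i⁆ = a • G.e i :=
  ⟨_, G.lie_e ⟨x, hx⟩ i⟩

lemma lie_cartan_f {x : g} (hx : x ∈ G.H) (i : I) : ∃ a : ℂ, ⁅x, G.f i⁆ = a • G.f i :=
  ⟨_, G.lie_f ⟨x, hx⟩ i⟩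

lemma lie_e_f_mem (i j : I) : ⁅G.e i, G.f j⁆ ∈ G.H := by
  rw [G.e_f]
  split_ifs
  · exact (G.coroot i).2
  · exact G.H.zero_mem

/-- The triangular decomposition. -/
lemma triangular_eq_top : iterSpan G.e ⊔ G.H ⊔ iterSpan G.f = ⊤ := by
  set Z := iterSpan G.e ⊔ G.H ⊔ iterSpan G.f with hZ
  have hE : iterSpan G.e ≤ Z := le_sup_left.trans le_sup_left
  have hH : G.H ≤ Z := le_sup_right.trans le_sup_left
  have hF : iterSpan G.f ≤ Z := le_sup_right
  refine eq_top_iff.2 fun x _ => ?_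
  refine lieSpan_le_of_lie_mem (Z := Z) ?_ ?_ (x := x) (by rw [G.generates]; trivial)
  · rintro x ((hx | ⟨i, rfl⟩) | ⟨i, rfl⟩)
    · exact hH hx
    · exact hE (mem_iterSpan _ i)
    · exact hF (mem_iterSpan _ i)
  · intro x hx z hz
    obtain ⟨w, hw, c, hc, rfl⟩ := Submodule.mem_sup.1 hz
    obtain ⟨a, ha, b, hb, rfl⟩ := Submodule.mem_sup.1 hw
    rw [lie_add, lie_add]
    obtain (hx | ⟨i, rfl⟩) | ⟨i, rfl⟩ := hx
    · refine add_mem (add_mem ?_ ?_) ?_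
      · exact hE (lie_cartan_mem_iterSpan (fun x hx i => lie_cartan_e G hx i) hx ha)
      · rw [G.abelian ⟨x, hx⟩ ⟨b, hb⟩]
        exact Z.zero_mem
      · exact hF (lie_cartan_mem_iterSpan (fun x hx i => lie_cartan_f G hx i) hx hc)
    · refine add_mem (add_mem (hE (lie_mem_iterSpan i ha)) ?_) ?_
      · obtain ⟨t, ht⟩ := lie_cartan_e G hb i
        rw [← lie_skew, ht]
        exact neg_mem (Submodule.smul_mem _ t (hE (mem_iterSpan _ i)))
      · exact sup_le hH hF (lie_mem_iterSpan_sup (fun x hx i => lie_cartan_f G hx i)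
          (lie_e_f_mem G) i hc)
    · refine add_mem (add_mem ?_ ?_) (hF (lie_mem_iterSpan i hc))
      · refine sup_le hH hE (lie_mem_iterSpan_sup (fun x hx i => lie_cartan_e G hx i) ?_ i ha)
        intro i j
        rw [← lie_skew]
        exact neg_mem (lie_e_f_mem G j i)
      · obtain ⟨t, ht⟩ := lie_cartan_f G hb i
        rw [← lie_skew, ht]
        exact neg_mem (Submodule.smul_mem _ t (hF (mem_iterSpan _ i)))

lemma exists_iterBracket_of_mem_Delta {χ : Module.Dual ℂ G.H} (hχ : χ ∈ Delta G) :
    (∃ j l, χ = rootComb G (iterWeight j l) ∧ iterBracket G.e j l ≠ 0) ∨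
      ∃ j l, χ = -rootComb G (iterWeight j l) ∧ iterBracket G.f j l ≠ 0 := by
  obtain ⟨x, hx, hx0⟩ := (Submodule.ne_bot_iff _).1 hχ.2
  set X : Set (Module.Dual ℂ G.H) := {χ | χ = 0 ∨
    (∃ j l, χ = rootComb G (iterWeight j l) ∧ iterBracket G.e j l ≠ 0) ∨
      ∃ j l, χ = -rootComb G (iterWeight j l) ∧ iterBracket G.f j l ≠ 0} with hX
  have htop : (⊤ : Submodule ℂ g) ≤ ⨆ ψ ∈ X, wtSpaceι G.H.subtype ψ := by
    rw [← triangular_eq_top G]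
    refine sup_le (sup_le ?_ ?_) ?_
    · refine Submodule.span_le.2 ?_
      rintro _ ⟨⟨j, l⟩, rfl⟩
      by_cases h : iterBracket G.e j l = 0
      · simp [h]
      · exact Submodule.mem_iSup_of_mem _ (Submodule.mem_iSup_of_mem
          (Or.inr (Or.inl ⟨j, l, rfl, h⟩)) (iterBracket_e_mem G j l))
    · exact le_trans (by rw [G.zero_weight]) (le_biSup (wtSpaceι G.H.subtype)
        (show (0 : Module.Dual ℂ G.H) ∈ X from Or.inl rfl))
    · refine Submodule.span_le.2 ?_
      rintro _ ⟨⟨j, l⟩, rfl⟩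
      by_cases h : iterBracket G.f j l = 0
      · simp [h]
      · exact Submodule.mem_iSup_of_mem _ (Submodule.mem_iSup_of_mem
          (Or.inr (Or.inr ⟨j, l, rfl, h⟩)) (iterBracket_f_mem G j l))
  exact (mem_of_mem_wtSpaceι G.abelian hx hx0 (htop trivial)).resolve_left hχ.1

lemma engel_eq_top {x : g}
    (h : ∀ y ∈ (G.H : Set g) ∪ Set.range G.e ∪ Set.range G.f,
      ∃ n : ℕ, (LieAlgebra.ad ℂ g x ^ n) y = 0) (y : g) :
    ∃ n : ℕ, (LieAlgebra.ad ℂ g x ^ n) y = 0 := by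
  have hle : LieSubalgebra.lieSpan ℂ g ((G.H : Set g) ∪ Set.range G.e ∪ Set.range G.f) ≤
      LieSubalgebra.engel ℂ x := LieSubalgebra.lieSpan_le.2 fun y hy =>
    (LieSubalgebra.mem_engel_iff ℂ x y).2 (h y hy)
  rw [G.generates] at hle
  exact (LieSubalgebra.mem_engel_iff ℂ x y).1 (hle trivial)

lemma ad_e_locally_nilpotent (i : I) (y : g) :
    ∃ n : ℕ, (LieAlgebra.ad ℂ g (G.e i) ^ n) y = 0 := by
  have hH : ∀ y ∈ G.H, ⁅G.e i, ⁅G.e i, y⁆⁆ = 0 := fun y hy => by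
    obtain ⟨t, ht⟩ := lie_cartan_e G hy i
    rw [← lie_skew _ y, ht]
    simp
  refine engel_eq_top G ?_ y
  rintro y ((hy | ⟨j, rfl⟩) | ⟨j, rfl⟩)
  · exact ⟨2, by simpa [pow_succ] using hH y hy⟩
  · by_cases hij : i = j
    · exact ⟨1, by simp [hij]⟩
    · exact ⟨_, G.serre_e i j hij⟩
  · exact ⟨3, by simpa [pow_succ] using hH _ (lie_e_f_mem G i j)⟩

lemma ad_f_locally_nilpotent (i : I) (y : g) :
    ∃ n : ℕ, (LieAlgebra.ad ℂ g (G.f i) ^ n) y = 0 := by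
  have hH : ∀ y ∈ G.H, ⁅G.f i, ⁅G.f i, y⁆⁆ = 0 := fun y hy => by
    obtain ⟨t, ht⟩ := lie_cartan_f G hy i
    rw [← lie_skew _ y, ht]
    simp
  refine engel_eq_top G ?_ y
  rintro y ((hy | ⟨j, rfl⟩) | ⟨j, rfl⟩)
  · exact ⟨2, by simpa [pow_succ] using hH y hy⟩
  · refine ⟨3, ?_⟩
    have h : ⁅G.f i, G.e j⁆ ∈ G.H := by
      rw [← lie_skew]
      exact neg_mem (lie_e_f_mem G j i)
    simpa [pow_succ] using hH _ h
  · by_cases hij : i = j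
    · exact ⟨1, by simp [hij]⟩
    · exact ⟨_, G.serre_f i j hij⟩

lemma root_mem_Delta (i : I) : G.root i ∈ Delta G := by
  refine ⟨G.indepRoot.ne_zero i, fun h => coroot_ne_zero G i ?_⟩
  have he : G.e i = 0 := by simpa [h] using e_mem_wtSpaceι G i
  have := G.e_f i i
  rw [if_pos rfl, he, zero_lie] at this
  exact this.symm

lemma neg_root_mem_Delta (i : I) : -G.root i ∈ Delta G := by
  refine ⟨neg_ne_zero.2 (G.indepRoot.ne_zero i), fun h => coroot_ne_zero G i ?_⟩
  have hf : G.f i = 0 := by simpa [h] using f_mem_wtSpaceι G i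
  have := G.e_f i i
  rw [if_pos rfl, hf, lie_zero] at this
  exact this.symm

/-- The root system of a Kac-Moody algebra, in coordinates. -/
def rootSet : Set (I → ℤ) := {c | rootComb G c ∈ Delta G}

lemma ad_e_pow_ne_zero (hA : IsGCM A) (i : I) {c : I → ℤ} {k : ℕ} (hk : A.mulVec c i = -k)
    {x : g} (hx : x ∈ wtSpaceι G.H.subtype (rootComb G c)) (hx0 : x ≠ 0) :
    (LieAlgebra.ad ℂ g (G.e i) ^ k) x ≠ 0 := by
  refine ad_pow_ne_zero (isSl2Triple G hA i) hx0 ?_ (ad_f_locally_nilpotent G i x)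
  have h := hx (G.coroot i)
  rw [rootComb_coroot, hk] at h
  exact_mod_cast h

lemma ad_f_pow_ne_zero (hA : IsGCM A) (i : I) {c : I → ℤ} {k : ℕ} (hk : A.mulVec c i = k)
    {x : g} (hx : x ∈ wtSpaceι G.H.subtype (rootComb G c)) (hx0 : x ≠ 0) :
    (LieAlgebra.ad ℂ g (G.f i) ^ k) x ≠ 0 := by
  refine ad_pow_ne_zero (isSl2Triple G hA i).symm hx0 ?_ (ad_e_locally_nilpotent G i x)
  have h := hx (G.coroot i)
  rw [rootComb_coroot, hk] at h
  rw [neg_lie, neg_smul, neg_inj]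
  exact_mod_cast h

lemma exists_eq_rootComb {χ : Module.Dual ℂ G.H} (hχ : χ ∈ Delta G) :
    ∃ c : I → ℤ, χ = rootComb G c := by
  obtain ⟨j, l, h, -⟩ | ⟨j, l, h, -⟩ := exists_iterBracket_of_mem_Delta G hχ
  · exact ⟨_, h⟩
  · exact ⟨-iterWeight j l, by rw [h, map_neg]⟩

lemma isRootSet (hA : IsGCM A) : IsRootSet A (rootSet G) := by
  have hR : ∀ c ∈ rootSet G, (∃ j l, c = iterWeight j l ∧ iterBracket G.e j l ≠ 0) ∨
      ∃ j l, c = -iterWeight j l := by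
    intro c hc
    obtain ⟨j, l, h, h0⟩ | ⟨j, l, h, -⟩ := exists_iterBracket_of_mem_Delta G hc
    · exact Or.inl ⟨j, l, rootComb_injective G h, h0⟩
    · exact Or.inr ⟨j, l, rootComb_injective G (by rw [h, map_neg])⟩
  have hpos : ∀ c ∈ rootSet G, 0 ≤ c →
      ∃ j l, c = iterWeight j l ∧ iterBracket G.e j l ≠ 0 := by
    intro c hc h0
    refine (hR c hc).resolve_right ?_
    rintro ⟨j, l, rfl⟩
    have h1 := h0 j
    have h2 := iterWeight_self_pos j l
    simp only [Pi.zero_apply, Pi.neg_apply] at h1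
    omega
  refine ⟨fun h => h.1 (map_zero _), ?_, ?_, ?_, ?_, ?_, ?_⟩
  · intro c hc
    obtain ⟨j, l, rfl, -⟩ | ⟨j, l, rfl⟩ := hR c hc
    · exact Or.inl (iterWeight_nonneg j l)
    · exact Or.inr (neg_nonpos.2 (iterWeight_nonneg j l))
  · intro i
    simpa [rootSet] using root_mem_Delta G i
  · intro i c hc
    obtain ⟨x, hx, hx0⟩ := (Submodule.ne_bot_iff _).1 hc.2
    refine ⟨fun h => hc.1 ?_, (Submodule.ne_bot_iff _).2 ?_⟩
    · rw [← map_zero (rootComb G)] at h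
      rw [← simpleRefl_simpleRefl hA i c, rootComb_injective G h, map_zero, map_zero]
    · rw [rootComb_simpleRefl, rootComb_coroot]
      obtain ⟨k, hk | hk⟩ := Int.eq_nat_or_neg (A.mulVec c i)
      · refine ⟨_, ?_, ad_f_pow_ne_zero G hA i hk hx hx0⟩
        rw [hk]
        convert ad_pow_mem_wtSpaceι (f_mem_wtSpaceι G i) hx k using 2
        push_cast
        module
      · refine ⟨_, ?_, ad_e_pow_ne_zero G hA i hk hx hx0⟩
        rw [hk]
        convert ad_pow_mem_wtSpaceι (e_mem_wtSpaceι G i) hx k using 2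
        push_cast
        module
  · intro i c hc hneg h0
    obtain ⟨x, hx, hx0⟩ := (Submodule.ne_bot_iff _).1 hc.2
    refine ⟨fun h => h0 (rootComb_injective G (h.trans (map_zero _).symm)),
      (Submodule.ne_bot_iff _).2 ⟨⁅G.e i, x⁆, ?_, fun h => ?_⟩⟩
    · rw [map_add, rootComb_single, add_comm]
      simpa using lie_mem_wtSpaceι (e_mem_wtSpaceι G i) hx
    · obtain ⟨k, hk⟩ : ∃ k : ℕ, A.mulVec c i = -((k + 1 : ℕ) : ℤ) :=
        ⟨(-A.mulVec c i - 1).toNat, by push_cast; omega⟩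
      refine ad_e_pow_ne_zero G hA i hk hx hx0 ?_
      rw [pow_succ, Module.End.mul_apply, LieAlgebra.ad_apply, h, map_zero]
  · intro i c hc h0 hi
    obtain ⟨j, l, rfl, h⟩ := hpos c hc h0
    exact iterWeight_eq_single h hi
  · intro c hc h0
    obtain ⟨j, l, rfl, h⟩ := hpos c hc h0
    exact suppConnected_iterWeight hA (fun i j => lie_e_e_eq_zero G) h

end Roots

end KMG

namespace KMG

/-! ### Rays of imaginary roots -/

section Antidominant

variable {I : Type*} {A : Matrix I I ℤ}

lemma exists_pos_symmetrizer (hA : IsGCM A) (hS : Symmetrizable A) :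
    ∃ d : I → ℚ, (∀ i, 0 < d i) ∧ ∀ i j, d i * (A i j : ℚ) = d j * (A j i : ℚ) := by
  obtain ⟨d, hd, hsym⟩ := hS
  refine ⟨fun i => |d i|, fun i => abs_pos.2 (hd i), fun i j => ?_⟩
  obtain rfl | hij := eq_or_ne i j
  · rfl
  have h := congrArg abs (hsym i j)
  have h1 : (A i j : ℚ) ≤ 0 := by exact_mod_cast hA.2.1 i j hij
  have h2 : (A j i : ℚ) ≤ 0 := by exact_mod_cast hA.2.1 j i hij.symm
  rw [abs_mul, abs_mul, abs_of_nonpos h1, abs_of_nonpos h2] at h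
  linarith

lemma SuppConnected.smul {c : I → ℤ} (h : SuppConnected A c) (n : ℤ) (hn : n ≠ 0) :
    SuppConnected A (n • c) := by
  intro X hX hX'
  simp only [Pi.smul_apply, smul_eq_mul, ne_eq, mul_eq_zero, hn, false_or] at hX hX' ⊢
  exact h X hX hX'

lemma suppConnected_of_pos (hInd : Indecomposable A) {c : I → ℤ} (hc : ∀ i, 0 < c i) :
    SuppConnected A c := by
  rintro X ⟨i, hi, -⟩ ⟨j, hj, -⟩
  obtain ⟨k, hk, l, hl, h⟩ := hInd X ⟨i, hi⟩ ⟨j, hj⟩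
  exact ⟨k, hk, l, hl, (hc k).ne', (hc l).ne', h⟩

variable [Fintype I]

lemma sum_mul_mulVec_comm {d : I → ℚ} (hd : ∀ i j, d i * (A i j : ℚ) = d j * (A j i : ℚ))
    (x y : I → ℤ) :
    ∑ i, d i * x i * (A.mulVec y i : ℚ) = ∑ i, d i * y i * (A.mulVec x i : ℚ) := by
  simp only [Matrix.mulVec, dotProduct, Int.cast_sum, Int.cast_mul, Finset.mul_sum]
  rw [Finset.sum_comm]
  refine Finset.sum_congr rfl fun i _ => Finset.sum_congr rfl fun j _ => ?_
  linear_combination (x j * y i : ℚ) * hd j i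

lemma mulVec_nonpos (hA : IsGCM A) {y : I → ℤ} (hy : 0 ≤ y) {i : I} (hi : y i = 0) :
    A.mulVec y i ≤ 0 := by
  refine Finset.sum_nonpos fun k _ => ?_
  obtain rfl | hk := eq_or_ne i k
  · simp [hi]
  · exact mul_nonpos_of_nonpos_of_nonneg (hA.2.1 _ _ hk) (hy k)

lemma mulVec_neg (hA : IsGCM A) {y : I → ℤ} (hy : 0 ≤ y) {i j : I} (hi : y i = 0)
    (hj : y j ≠ 0) (hij : A i j ≠ 0) : A.mulVec y i < 0 := by
  have hne : i ≠ j := fun h => hj (h ▸ hi)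
  refine Finset.sum_neg' (fun k _ => ?_) ⟨j, Finset.mem_univ j, ?_⟩
  · obtain rfl | hk := eq_or_ne i k
    · simp [hi]
    · exact mul_nonpos_of_nonpos_of_nonneg (hA.2.1 _ _ hk) (hy k)
  · exact mul_neg_of_neg_of_pos (lt_of_le_of_ne (hA.2.1 _ _ hne) hij)
      (lt_of_le_of_ne (hy j) (Ne.symm hj))

/-- A nonnegative vector, supported in the connected support of `c` and annihilated there by `A`,
which vanishes at a point of the support of `c`, is zero. -/
lemma eq_zero_of_mulVec_eq_zero (hA : IsGCM A) {c w : I → ℤ} (hconn : SuppConnected A c)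
    (hw : 0 ≤ w) (hsupp : ∀ i, c i = 0 → w i = 0) (hAw : ∀ i, c i ≠ 0 → A.mulVec w i = 0)
    {i₀ : I} (hi₀ : c i₀ ≠ 0) (hwi₀ : w i₀ = 0) : w = 0 := by
  by_contra hne
  obtain ⟨j, hj⟩ := Function.ne_iff.1 hne
  obtain ⟨i, hi, k, hk, hci, -, hik⟩ := hconn {i | w i = 0} ⟨i₀, hwi₀, hi₀⟩
    ⟨j, hj, fun h => hj (hsupp j h)⟩
  exact (mulVec_neg hA hw hi hk hik).ne (hAw i hci)

lemma proportional_of_null (hA : IsGCM A) {c b : I → ℤ} (hconn : SuppConnected A c)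
    (hc0 : 0 ≤ c) (hcne : c ≠ 0) (hb0 : 0 ≤ b) (hsupp : ∀ i, c i = 0 ↔ b i = 0)
    (hAc : ∀ i, c i ≠ 0 → A.mulVec c i = 0) (hAb : ∀ i, c i ≠ 0 → A.mulVec b i = 0) :
    ∃ p q : ℤ, 0 < p ∧ 0 < q ∧ q • b = p • c := by
  obtain ⟨j, hj⟩ := Function.ne_iff.1 hcne
  obtain ⟨i₀, hi₀, hmin⟩ := Finset.exists_min_image (Finset.univ.filter fun i => c i ≠ 0)
    (fun i => (c i : ℚ) / b i) ⟨j, by simpa using hj⟩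
  have hi₀ : c i₀ ≠ 0 := by simpa using hi₀
  have hci : 0 < c i₀ := lt_of_le_of_ne (hc0 i₀) (Ne.symm hi₀)
  have hbi : 0 < b i₀ := lt_of_le_of_ne (hb0 i₀) fun h => hi₀ ((hsupp i₀).2 h.symm)
  refine ⟨b i₀, c i₀, hbi, hci, ?_⟩
  have hw : b i₀ • c - c i₀ • b = 0 := by
    refine eq_zero_of_mulVec_eq_zero hA hconn (fun i => ?_) (fun i hi => ?_) (fun i hi => ?_)
      hi₀ ?_
    · simp only [Pi.zero_apply, Pi.sub_apply, Pi.smul_apply, smul_eq_mul, sub_nonneg]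
      by_cases hi : c i = 0
      · simp [hi, (hsupp i).1 hi]
      · have h := hmin i (by simpa using hi)
        have hbi' : 0 < b i := lt_of_le_of_ne (hb0 i) fun h => hi ((hsupp i).2 h.symm)
        rw [div_le_div_iff₀ (by exact_mod_cast hbi) (by exact_mod_cast hbi')] at h
        have : c i₀ * b i ≤ c i * b i₀ := by exact_mod_cast h
        linarith
    · simp [hi, (hsupp i).1 hi]
    · rw [Matrix.mulVec_sub, Matrix.mulVec_smul, Matrix.mulVec_smul, Pi.sub_apply, Pi.smul_apply,
        Pi.smul_apply, hAc i hi, hAb i hi, smul_zero, smul_zero, sub_zero]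
    · simp [mul_comm]
  exact (sub_eq_zero.1 hw).symm

/-- A maximal root below an antidominant vector with connected support is proportional to it. -/
lemma proportional_of_maximal (hA : IsGCM A) (hS : Symmetrizable A) {c b : I → ℤ}
    (hc : ∀ i, A.mulVec c i ≤ 0) (hconn : SuppConnected A c) (hb0 : 0 ≤ b) (hbne : b ≠ 0)
    (hle : b ≤ c) (hmax : ∀ i, b i < c i → 0 ≤ A.mulVec b i) :
    ∃ p q : ℤ, 0 < p ∧ 0 < q ∧ q • b = p • c := by
  obtain ⟨d, hd, hsym⟩ := exists_pos_symmetrizer hA hS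
  have hc0 : 0 ≤ c := hb0.trans hle
  have hsupp : ∀ i, c i = 0 ↔ b i = 0 := by
    intro i
    refine ⟨fun h => le_antisymm ((hle i).trans_eq h) (hb0 i), fun h => ?_⟩
    by_contra hci
    obtain ⟨j, hj⟩ := Function.ne_iff.1 hbne
    obtain ⟨k, hk, l, hl, hck, -, hkl⟩ := hconn {i | b i = 0} ⟨i, h, hci⟩
      ⟨j, hj, fun h : c j = 0 => hj (le_antisymm ((hle j).trans_eq h) (hb0 j))⟩
    have h1 : b k < c k := lt_of_le_of_ne (hle k) fun h => hck (h ▸ hk)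
    exact absurd (hmax k h1) (not_le.2 (mulVec_neg hA hb0 hk hl hkl))
  set v := c - b with hv
  set u : I → ℤ := fun i => if b i < c i then b i else 0 with hu
  set u' : I → ℤ := fun i => if b i < c i then 0 else b i with hu'
  have huu' : b = u + u' := by
    ext i
    simp only [hu, hu', Pi.add_apply]
    split_ifs <;> simp
  have hu'0 : 0 ≤ u' := fun i => by
    simp only [hu', Pi.zero_apply]
    split_ifs
    exacts [le_rfl, hb0 i]
  have hAv : ∀ i, b i < c i → A.mulVec v i ≤ 0 := fun i hi => by
    rw [hv, Matrix.mulVec_sub, Pi.sub_apply]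
    linarith [hmax i hi, hc i]
  have hAu' : ∀ i, b i < c i → A.mulVec u' i ≤ 0 := fun i hi =>
    mulVec_nonpos hA hu'0 (by simp [hu', hi])
  have hAb : ∀ i, A.mulVec b i = A.mulVec u i + A.mulVec u' i := fun i => by
    conv_lhs => rw [huu', Matrix.mulVec_add, Pi.add_apply]
  have hAu : ∀ i, b i < c i → 0 ≤ A.mulVec u i := fun i hi => by
    linarith [hmax i hi, hAu' i hi, hAb i]
  have hneg : ∀ i ∈ Finset.univ, d i * u i * (A.mulVec v i : ℚ) ≤ 0 := by
    intro i _
    by_cases hi : b i < c i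
    · have h1 : (0 : ℚ) ≤ u i := by
        have := hb0 i
        simp only [hu, if_pos hi]
        exact_mod_cast this
      have h2 : (A.mulVec v i : ℚ) ≤ 0 := by exact_mod_cast hAv i hi
      exact mul_nonpos_of_nonneg_of_nonpos (mul_nonneg (hd i).le h1) h2
    · simp [hu, hi]
  have hpos : ∀ i ∈ Finset.univ, 0 ≤ d i * v i * (A.mulVec u i : ℚ) := by
    intro i _
    by_cases hi : b i < c i
    · have h1 : (0 : ℚ) ≤ v i := by
        have := hle i
        simp only [hv, Pi.sub_apply]
        exact_mod_cast sub_nonneg.2 this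
      have h2 : (0 : ℚ) ≤ (A.mulVec u i : ℚ) := by exact_mod_cast hAu i hi
      exact mul_nonneg (mul_nonneg (hd i).le h1) h2
    · have : v i = 0 := by simp only [hv, Pi.sub_apply]; linarith [hle i]
      simp [this]
  have hsum := sum_mul_mulVec_comm hsym u v
  have hsum0 : ∑ i, d i * u i * (A.mulVec v i : ℚ) = 0 :=
    le_antisymm (Finset.sum_nonpos hneg) (hsum ▸ Finset.sum_nonneg hpos)
  have hAv0 : ∀ i, b i < c i → A.mulVec v i = 0 := by
    intro i hi
    have h := (Finset.sum_eq_zero_iff_of_nonpos hneg).1 hsum0 i (Finset.mem_univ i)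
    have hbi : b i ≠ 0 := fun h => hi.ne (by rw [h, (hsupp i).2 h])
    simp only [hu, if_pos hi, mul_eq_zero, (hd i).ne', false_or, Int.cast_eq_zero] at h
    exact h.resolve_left hbi
  have hAu0 : ∀ i, b i < c i → A.mulVec u i = 0 := by
    intro i hi
    have h := (Finset.sum_eq_zero_iff_of_nonneg hpos).1 (hsum ▸ hsum0) i (Finset.mem_univ i)
    have hvi : v i ≠ 0 := by simp only [hv, Pi.sub_apply]; omega
    simp only [mul_eq_zero, (hd i).ne', false_or, Int.cast_eq_zero] at h
    exact h.resolve_left hvi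
  by_cases hne : ∃ i, b i < c i
  · obtain ⟨i₁, hi₁⟩ := hne
    have hall : ∀ i, c i ≠ 0 → b i < c i := by
      by_contra! h
      obtain ⟨j, hj, hjb⟩ := h
      obtain ⟨i, hi, k, hk, -, hck, hik⟩ := hconn {i | b i < c i}
        ⟨i₁, hi₁, ((hb0 i₁).trans_lt hi₁).ne'⟩ ⟨j, not_lt.2 hjb, hj⟩
      have hi : b i < c i := hi
      have hk : ¬ b k < c k := hk
      have hlt : A.mulVec u' i < 0 := mulVec_neg hA hu'0 (by simp [hu', hi]) (j := k)
        (by simpa [hu', hk] using fun h => hck ((hsupp k).2 h)) hik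
      linarith [hmax i hi, hAu0 i hi, hAb i]
    have hAb0 : ∀ i, c i ≠ 0 → A.mulVec b i = 0 := fun i hi =>
      le_antisymm (by linarith [hAu' i (hall i hi), hAu0 i (hall i hi), hAb i])
        (hmax i (hall i hi))
    refine proportional_of_null hA hconn hc0 (fun h => ?_) hb0 hsupp (fun i hi => ?_) hAb0
    · exact hbne (funext fun i => (hsupp i).1 (by simp [h]))
    · have h := hAv0 i (hall i hi)
      rw [hv, Matrix.mulVec_sub, Pi.sub_apply, hAb0 i hi, sub_zero] at h
      exact h
  · push Not at hne
    exact ⟨1, 1, one_pos, one_pos, by rw [le_antisymm hle hne]⟩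

end Antidominant

section Gradings

variable {I S : Type*} {R : Set (I → ℤ)}

/-- The roots which are positive rational multiples of `c`. -/
def rayRoots (R : Set (I → ℤ)) (c : I → ℤ) : Set (I → ℤ) :=
  {r ∈ R | ∃ p q : ℤ, 0 < p ∧ 0 < q ∧ q • r = p • c}

/-- `L` is the restriction map of a finite gradation: it sends roots to nonnegative or nonpositive
vectors, and its fibres on the set of roots are finite. -/
structure IsGradingMap (R : Set (I → ℤ)) (L : (I → ℤ) →+ (S → ℤ)) : Prop where
  nonneg_or_nonpos : ∀ c ∈ R, 0 ≤ L c ∨ L c ≤ 0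
  finite_fiber : ∀ y, {c ∈ R | L c = y}.Finite

lemma IsGradingMap.ne_zero {L : (I → ℤ) →+ (S → ℤ)} (hL : IsGradingMap R L) {c : I → ℤ}
    (hc : (rayRoots R c).Infinite) : L c ≠ 0 := by
  intro h
  refine hc ((hL.finite_fiber 0).subset ?_)
  rintro r ⟨hr, p, q, hp, hq, hpq⟩
  refine ⟨hr, ?_⟩
  have h1 : q • L r = 0 := by rw [← map_zsmul, hpq, map_zsmul, h, smul_zero]
  exact (smul_eq_zero.1 h1).resolve_left hq.ne'

lemma IsGradingMap.sign {L : (I → ℤ) →+ (S → ℤ)} (hL : IsGradingMap R L) {c : I → ℤ}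
    (hc : (rayRoots R c).Infinite) : 0 ≤ L c ∨ L c ≤ 0 := by
  obtain ⟨r, hr, p, q, hp, hq, hpq⟩ := hc.nonempty
  have h1 : q • L r = p • L c := by rw [← map_zsmul, hpq, map_zsmul]
  have h2 : ∀ s, q * L r s = p * L c s := fun s => congrFun h1 s
  refine (hL.nonneg_or_nonpos r hr).imp (fun h s => ?_) (fun h s => ?_)
  · have h3 : 0 ≤ L r s := h s
    exact nonneg_of_mul_nonneg_right (h2 s ▸ mul_nonneg hq.le h3) hp
  · have h3 : L r s ≤ 0 := h s
    have h4 : p * L c s ≤ 0 := h2 s ▸ mul_nonpos_of_nonneg_of_nonpos hq.le h3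
    exact (mul_nonpos_iff_pos_imp_nonpos.1 h4).1 hp

/-- A pencil of vectors, all of whose members have constant sign, one being nonnegative and another
one nonpositive, contains zero. -/
lemma exists_combination {u v : S → ℤ} (hu : 0 ≤ u) (hu0 : u ≠ 0) (hv : v ≤ 0) (hv0 : v ≠ 0)
    (h : ∀ p q : ℤ, 0 < p → 0 < q → 0 ≤ p • u + q • v ∨ p • u + q • v ≤ 0) :
    ∃ p q : ℤ, 0 < p ∧ 0 < q ∧ p • u + q • v = 0 := by
  have hmix : ∀ p q : ℤ, 0 < p → 0 < q → ∀ s t, p * u s + q * v s < 0 →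
      0 < p * u t + q * v t → False := by
    intro p q hp hq s t hs ht
    obtain h | h := h p q hp hq
    · exact absurd (h s) (not_le.2 hs)
    · exact absurd (h t) (not_le.2 ht)
  obtain ⟨s, hs⟩ := Function.ne_iff.1 hu0
  have hus : 0 < u s := lt_of_le_of_ne (hu s) (Ne.symm hs)
  obtain ⟨t, ht⟩ := Function.ne_iff.1 hv0
  have hvt : v t < 0 := lt_of_le_of_ne (hv t) ht
  have hvs : v s < 0 := by
    refine lt_of_le_of_ne (hv s) fun h0 : v s = 0 => ?_
    refine hmix 1 (u t + 1) one_pos (by have := hu t; simp only [Pi.zero_apply] at this; omega)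
      t s ?_ ?_
    · have := hu t
      simp only [Pi.zero_apply] at this
      nlinarith
    · rw [h0]; linarith
  refine ⟨-v s, u s, by omega, hus, funext fun r => ?_⟩
  by_contra hr
  have hur : 0 ≤ u r := hu r
  have hvr : v r ≤ 0 := hv r
  obtain hlt | hgt := lt_or_gt_of_ne hr
  · simp only [Pi.add_apply, Pi.smul_apply, smul_eq_mul, Pi.zero_apply] at hlt
    refine hmix ((u r + 1) * -v s + 1) ((u r + 1) * u s) (by nlinarith) (by nlinarith) r s ?_ ?_
    · nlinarith
    · nlinarith
  · simp only [Pi.add_apply, Pi.smul_apply, smul_eq_mul, Pi.zero_apply] at hgt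
    refine hmix ((-v r + 1) * -v s) ((-v r + 1) * u s + 1) (by nlinarith) (by nlinarith) s r ?_ ?_
    · nlinarith
    · nlinarith

lemma IsGradingMap.nonneg_of_linked {L : (I → ℤ) →+ (S → ℤ)} (hL : IsGradingMap R L)
    {a b : I → ℤ} (ha : (rayRoots R a).Infinite) (hb : (rayRoots R b).Infinite)
    (hab : ∀ p q : ℤ, 0 < p → 0 < q → (rayRoots R (p • a + q • b)).Infinite)
    (h : 0 ≤ L a) : 0 ≤ L b := by
  refine (hL.sign hb).resolve_right fun hneg => ?_
  obtain ⟨p, q, hp, hq, h0⟩ := exists_combination h (hL.ne_zero ha) hneg (hL.ne_zero hb)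
    (fun p q hp hq => by
      rw [← map_zsmul, ← map_zsmul, ← map_add]
      exact hL.sign (hab p q hp hq))
  exact hL.ne_zero (hab p q hp hq) (by rw [map_add, map_zsmul, map_zsmul, h0])

lemma IsGradingMap.nonneg_iff_of_linked {L : (I → ℤ) →+ (S → ℤ)} (hL : IsGradingMap R L)
    {a b : I → ℤ} (ha : (rayRoots R a).Infinite) (hb : (rayRoots R b).Infinite)
    (hab : ∀ p q : ℤ, 0 < p → 0 < q → (rayRoots R (p • a + q • b)).Infinite) :
    0 ≤ L a ↔ 0 ≤ L b :=
  ⟨hL.nonneg_of_linked ha hb hab, hL.nonneg_of_linked hb ha fun p q hp hq => by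
    rw [add_comm]; exact hab q p hq hp⟩

end Gradings

section RootSets

variable {I : Type*} [Fintype I] [DecidableEq I] {A : Matrix I I ℤ} {R : Set (I → ℤ)}

lemma simpleRefl_injective (hA : IsGCM A) (i : I) : Function.Injective (simpleRefl A i) :=
  Function.LeftInverse.injective (simpleRefl_simpleRefl hA i)

lemma simpleRefl_apply_of_ne {i j : I} (h : j ≠ i) (c : I → ℤ) : simpleRefl A i c j = c j := by
  simp [simpleRefl_apply, h]

lemma IsRootSet.exists_ne (hR : IsRootSet A R) {i : I} {c : I → ℤ} (hc : c ∈ R) (h0 : 0 ≤ c)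
    (hne : c ≠ Pi.single i 1) : ∃ j, j ≠ i ∧ c j ≠ 0 := by
  by_contra! h
  exact hne (hR.eq_single i c hc h0 h)

lemma IsRootSet.simpleRefl_nonneg (hR : IsRootSet A R) {i : I} {c : I → ℤ} (hc : c ∈ R)
    (h0 : 0 ≤ c) (hne : c ≠ Pi.single i 1) : 0 ≤ simpleRefl A i c := by
  obtain ⟨j, hji, hj⟩ := hR.exists_ne hc h0 hne
  refine (hR.nonneg_or_nonpos _ (hR.simpleRefl_mem i c hc)).resolve_right fun h => hj ?_
  have h1 := h j
  rw [simpleRefl_apply_of_ne hji] at h1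
  exact le_antisymm h1 (h0 j)

/-- There are infinitely many positive roots supported in the support of an antidominant
vector. -/
lemma IsRootSet.infinite_of_antidominant (hR : IsRootSet A R) (hA : IsGCM A)
    (hS : Symmetrizable A) {c : I → ℤ} (h0 : 0 ≤ c) (hne : c ≠ 0)
    (hc : ∀ i, A.mulVec c i ≤ 0) : {r ∈ R | 0 ≤ r ∧ ∀ i, c i = 0 → r i = 0}.Infinite := by
  intro hfin
  obtain ⟨d, hd, hsym⟩ := exists_pos_symmetrizer hA hS
  set F := hfin.toFinset with hF
  have hmem : ∀ r, r ∈ F ↔ r ∈ R ∧ 0 ≤ r ∧ ∀ i, c i = 0 → r i = 0 := fun r => by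
    rw [hF, Set.Finite.mem_toFinset]; rfl
  have htwo : ∀ i, c i ≠ 0 → A.mulVec (∑ r ∈ F, r) i = 2 := by
    intro i hi
    have hiF : Pi.single i 1 ∈ F := by
      refine (hmem _).2 ⟨hR.single_mem i, Pi.single_nonneg.2 zero_le_one, fun j hj => ?_⟩
      exact Pi.single_eq_of_ne (fun h : j = i => hi (h ▸ hj)) 1
    have hz : ∑ r ∈ F.erase (Pi.single i 1), A.mulVec r i = 0 := by
      have hself : ∀ r, A.mulVec (simpleRefl A i r) i = -A.mulVec r i := fun r => by
        rw [mulVec_simpleRefl, hA.1 i]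
        ring
      refine Finset.sum_involution (fun r _ => simpleRefl A i r) (fun r _ => ?_)
        (fun r _ hr h => ?_) (fun r hr => ?_) (fun r _ => simpleRefl_simpleRefl hA i r)
      · rw [hself]; ring
      · have := hself r
        rw [h] at this
        omega
      · obtain ⟨hri, hrF⟩ := Finset.mem_erase.1 hr
        obtain ⟨hrR, hr0, hrs⟩ := (hmem r).1 hrF
        obtain ⟨j, hji, hj⟩ := hR.exists_ne hrR hr0 hri
        refine Finset.mem_erase.2 ⟨fun h => hj ?_, (hmem _).2 ⟨hR.simpleRefl_mem i r hrR,
          hR.simpleRefl_nonneg hrR hr0 hri, fun k hk => ?_⟩⟩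
        · have := congrFun h j
          rwa [simpleRefl_apply_of_ne hji, Pi.single_eq_of_ne hji] at this
        · rw [simpleRefl_apply_of_ne (fun h : k = i => hi (h ▸ hk))]
          exact hrs k hk
    rw [Matrix.mulVec_sum, Finset.sum_apply, ← Finset.add_sum_erase F _ hiF, hz,
      Matrix.mulVec_single]
    simp [hA.1 i]
  have hσ : (0 : I → ℤ) ≤ ∑ r ∈ F, r := Finset.sum_nonneg fun r hr => ((hmem r).1 hr).2.1
  have hsum := sum_mul_mulVec_comm hsym c (∑ r ∈ F, r)
  obtain ⟨j, hj⟩ := Function.ne_iff.1 hne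
  have hneg : ∑ i, d i * (∑ r ∈ F, r) i * (A.mulVec c i : ℚ) ≤ 0 := by
    refine Finset.sum_nonpos fun i _ => mul_nonpos_of_nonneg_of_nonpos
      (mul_nonneg (hd i).le ?_) ?_
    · exact_mod_cast hσ i
    · exact_mod_cast hc i
  have hpos : 0 < ∑ i, d i * c i * (A.mulVec (∑ r ∈ F, r) i : ℚ) := by
    have hcpos : ∀ i, c i ≠ 0 → (0 : ℚ) < c i := fun i hi => by
      exact_mod_cast lt_of_le_of_ne (h0 i) (Ne.symm hi)
    have hterm : ∀ i, c i ≠ 0 → 0 < d i * c i * (A.mulVec (∑ r ∈ F, r) i : ℚ) := fun i hi => by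
      rw [htwo i hi]
      exact mul_pos (mul_pos (hd i) (hcpos i hi)) (by norm_num)
    refine Finset.sum_pos' (fun i _ => ?_) ⟨j, Finset.mem_univ j, hterm j hj⟩
    by_cases hi : c i = 0
    · simp [hi]
    · exact (hterm i hi).le
  rw [hsum] at hpos
  exact absurd hneg (not_le.2 hpos)

lemma exists_sum_gt_of_infinite {X : Set (I → ℤ)} (hX : X.Infinite) (h0 : ∀ r ∈ X, 0 ≤ r)
    (N : ℤ) : ∃ r ∈ X, N < ∑ i, r i := by
  by_contra! h
  refine hX ((Set.finite_Icc (0 : I → ℤ) fun _ => N).subset fun r hr => ⟨h0 r hr, fun i => ?_⟩)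
  exact (Finset.single_le_sum (fun j _ => h0 r hr j) (Finset.mem_univ i)).trans (h r hr)

/-- The ray spanned by an antidominant vector with connected support contains infinitely many
roots. -/
lemma IsRootSet.infinite_rayRoots (hR : IsRootSet A R) (hA : IsGCM A)
    (hS : Symmetrizable A) {c : I → ℤ} (h0 : 0 ≤ c) (hne : c ≠ 0)
    (hc : ∀ i, A.mulVec c i ≤ 0) (hconn : SuppConnected A c) : (rayRoots R c).Infinite := by
  have hunb : ∀ N : ℤ, ∃ b ∈ rayRoots R c, N < ∑ i, b i := by
    intro N
    obtain ⟨r, ⟨hrR, hr0, hrs⟩, hN⟩ := exists_sum_gt_of_infinite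
      (hR.infinite_of_antidominant hA hS h0 hne hc) (fun r hr => hr.2.1) N
    set n : ℤ := 1 + ∑ i, r i with hn
    have hn0 : 0 < n := by
      have : 0 ≤ ∑ i, r i := Finset.sum_nonneg fun i _ => hr0 i
      omega
    have hrn : r ≤ n • c := by
      intro i
      by_cases hi : c i = 0
      · simp [hi, hrs i hi]
      · have h1 : r i ≤ ∑ i, r i := Finset.single_le_sum (fun j _ => hr0 j) (Finset.mem_univ i)
        have h2 : 1 ≤ c i := lt_of_le_of_ne (h0 i) (Ne.symm hi)
        simp only [Pi.smul_apply, smul_eq_mul]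
        nlinarith
    obtain ⟨b, ⟨hbR, hb0, hbn⟩, hbmax⟩ := Set.exists_max_image
      {b ∈ R | 0 ≤ b ∧ b ≤ n • c} (fun b => ∑ i, b i)
      ((Set.finite_Icc (0 : I → ℤ) (n • c)).subset fun b hb => hb.2) ⟨r, hrR, hr0, hrn⟩
    obtain ⟨p, q, hp, hq, h⟩ := proportional_of_maximal hA hS (c := n • c) (b := b)
      (fun i => by
        rw [Matrix.mulVec_smul]
        exact mul_nonpos_of_nonneg_of_nonpos hn0.le (hc i))
      (hconn.smul n hn0.ne') hb0 (fun h => hR.zero_notMem (h ▸ hbR)) hbn (fun i hi => by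
        by_contra! hlt
        have h1 : (0 : I → ℤ) ≤ Pi.single i 1 := Pi.single_nonneg.2 zero_le_one
        have h2 : (b + Pi.single i 1 : I → ℤ) i ≠ 0 := by
          have := hb0 i
          simp only [Pi.zero_apply] at this
          simp only [Pi.add_apply, Pi.single_eq_same]
          omega
        have h3 := hbmax (b + Pi.single i 1) ⟨hR.add_single_mem i b hbR hlt
          (fun h => h2 (by rw [h]; rfl)), add_nonneg hb0 h1, fun j => ?_⟩
        · simp [Finset.sum_add_distrib] at h3
        · obtain rfl | hj := eq_or_ne j i
          · simpa using hi
          · simpa [hj] using hbn j)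
    refine ⟨b, ⟨hbR, p * n, q, mul_pos hp hn0, hq, by rw [h, mul_smul]⟩,
      hN.trans_le (hbmax r ⟨hrR, hr0, hrn⟩)⟩
  intro hfin
  obtain ⟨b, hb, hmax⟩ := Set.exists_max_image _ (fun b : I → ℤ => ∑ i, b i) hfin
    (let ⟨b, hb, _⟩ := hunb 0; ⟨b, hb⟩)
  obtain ⟨b', hb', hlt⟩ := hunb (∑ i, b i)
  exact absurd (hmax b' hb') (not_le.2 hlt)

lemma IsRootSet.infinite_rayRoots_simpleRefl (hR : IsRootSet A R) (hA : IsGCM A) {c : I → ℤ}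
    (h : (rayRoots R c).Infinite) (i : I) : (rayRoots R (simpleRefl A i c)).Infinite := by
  refine (h.image (simpleRefl_injective hA i).injOn).mono ?_
  rintro _ ⟨r, ⟨hr, p, q, hp, hq, hpq⟩, rfl⟩
  exact ⟨hR.simpleRefl_mem i r hr, p, q, hp, hq, by rw [← map_smul, hpq, map_smul]⟩

/-- An antidominant vector can be enlarged to one with full support. -/
lemma exists_pos_antidominant (hA : IsGCM A) (hInd : Indecomposable A) {c : I → ℤ}
    (h0 : 0 ≤ c) (hne : c ≠ 0) (hc : ∀ i, A.mulVec c i ≤ 0) :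
    ∃ x : I → ℤ, (∀ i, 0 < x i) ∧ ∀ i, A.mulVec x i ≤ 0 := by
  induction hn : (Finset.univ.filter fun i => c i = 0).card using Nat.strong_induction_on
    generalizing c with
  | _ n ih =>
  by_cases hfull : ∀ i, c i ≠ 0
  · exact ⟨c, fun i => lt_of_le_of_ne (h0 i) (Ne.symm (hfull i)), hc⟩
  push Not at hfull
  obtain ⟨k, hk⟩ := hfull
  obtain ⟨l, hl⟩ := Function.ne_iff.1 hne
  obtain ⟨j, hj, i, hi, hji⟩ := hInd {i | c i = 0} ⟨k, hk⟩ ⟨l, hl⟩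
  have hj : c j = 0 := hj
  have hi : c i ≠ 0 := hi
  have hlt := mulVec_neg hA h0 hj hi hji
  have h1 : (0 : I → ℤ) ≤ Pi.single j 1 := Pi.single_nonneg.2 zero_le_one
  have hadd : ∀ m, ((2 : ℤ) • c + Pi.single j 1 : I → ℤ) m = 2 * c m + (Pi.single j 1 : I → ℤ) m :=
    fun m => rfl
  refine ih _ ?_ (c := (2 : ℤ) • c + Pi.single j 1) (add_nonneg (smul_nonneg zero_le_two h0) h1)
    (fun h => ?_) (fun m => ?_) rfl
  · rw [← hn]
    refine Finset.card_lt_card ⟨fun m hm => ?_, fun hsub => ?_⟩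
    · simp only [Finset.mem_filter, Finset.mem_univ, true_and, hadd] at hm ⊢
      have := h0 m
      have := h1 m
      simp only [Pi.zero_apply] at *
      omega
    · have := hsub (x := j) (by simpa using hj)
      simp [hj] at this
  · have := congrFun h j
    simp [hj] at this
  · rw [Matrix.mulVec_add, Matrix.mulVec_smul, Matrix.mulVec_single]
    obtain rfl | hm := eq_or_ne m j
    · simp [hA.1]
      omega
    · have := hA.2.1 m j hm
      have := hc m
      simp
      omega

/-- Every positive imaginary root is conjugate to an antidominant one. -/
lemma IsRootSet.imaginary_induction (hR : IsRootSet A R) (hA : IsGCM A) {Im : Set (I → ℤ)}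
    (hIm : Im ⊆ R) (hsingle : ∀ i, Pi.single i 1 ∉ Im)
    (hrefl : ∀ i, ∀ c ∈ Im, simpleRefl A i c ∈ Im) {P : (I → ℤ) → Prop}
    (hdom : ∀ c ∈ Im, 0 ≤ c → (∀ i, A.mulVec c i ≤ 0) → P c)
    (hP : ∀ c i, P c → P (simpleRefl A i c)) {c : I → ℤ} (hc : c ∈ Im) (h0 : 0 ≤ c) : P c := by
  induction hn : (∑ i, c i).toNat using Nat.strong_induction_on generalizing c with
  | _ n ih =>
  by_cases hK : ∀ i, A.mulVec c i ≤ 0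
  · exact hdom c hc h0 hK
  push Not at hK
  obtain ⟨i, hi⟩ := hK
  have hs0 := hR.simpleRefl_nonneg (hIm hc) h0 (fun h => hsingle i (h ▸ hc))
  have hsum : ∑ j, simpleRefl A i c j = ∑ j, c j - A.mulVec c i := by
    simp [simpleRefl_apply, Finset.sum_sub_distrib]
  have hs0' : 0 ≤ ∑ j, simpleRefl A i c j := Finset.sum_nonneg fun j _ => hs0 j
  rw [← simpleRefl_simpleRefl hA i c]
  exact hP _ i (ih _ (by omega) (hrefl i c hc) hs0 rfl)

variable {S : Type*}

lemma IsGradingMap.comp_simpleRefl (hR : IsRootSet A R) (hA : IsGCM A) {L : (I → ℤ) →+ (S → ℤ)}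
    (hL : IsGradingMap R L) (i : I) :
    IsGradingMap R (L.comp (simpleRefl A i).toAddMonoidHom) where
  nonneg_or_nonpos c hc := hL.nonneg_or_nonpos _ (hR.simpleRefl_mem i c hc)
  finite_fiber y := ((hL.finite_fiber y).preimage (simpleRefl_injective hA i).injOn).subset
    fun c hc => ⟨hR.simpleRefl_mem i c hc.1, hc.2⟩

/-- Linkage of positive imaginary roots: their images under the restriction map of a finite
gradation all have the same sign. -/
theorem IsRootSet.imaginary_sign (hR : IsRootSet A R) (hA : IsGCM A) (hInd : Indecomposable A)
    (hS : Symmetrizable A) {Im : Set (I → ℤ)} (hIm : Im ⊆ R)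
    (hsingle : ∀ i, Pi.single i 1 ∉ Im) (hrefl : ∀ i, ∀ c ∈ Im, simpleRefl A i c ∈ Im)
    {L : (I → ℤ) →+ (S → ℤ)} (hL : IsGradingMap R L) :
    (∀ c ∈ Im, 0 ≤ c → (rayRoots R c).Infinite) ∧
      ((∀ c ∈ Im, 0 ≤ c → 0 ≤ L c) ∨ ∀ c ∈ Im, 0 ≤ c → L c ≤ 0) := by
  have hray : ∀ c ∈ Im, 0 ≤ c → (rayRoots R c).Infinite := fun c hc h0 =>
    hR.imaginary_induction hA hIm hsingle hrefl (P := fun c => (rayRoots R c).Infinite)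
      (fun c hc h0 hK => hR.infinite_rayRoots hA hS h0 (fun h => hR.zero_notMem (h ▸ hIm hc)) hK
        (hR.suppConnected c (hIm hc) h0))
      (fun c i h => hR.infinite_rayRoots_simpleRefl hA h i) hc h0
  refine ⟨hray, ?_⟩
  by_cases hemp : ∃ c ∈ Im, 0 ≤ c
  swap
  · exact Or.inl fun c hc h0 => absurd ⟨c, hc, h0⟩ hemp
  obtain ⟨c₀, hc₀, h0⟩ := hemp
  obtain ⟨x, hx, hxK⟩ : ∃ x : I → ℤ, (∀ i, 0 < x i) ∧ ∀ i, A.mulVec x i ≤ 0 :=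
    hR.imaginary_induction hA hIm hsingle hrefl
      (P := fun _ => ∃ x : I → ℤ, (∀ i, 0 < x i) ∧ ∀ i, A.mulVec x i ≤ 0)
      (fun c hc h0 hK => exists_pos_antidominant hA hInd h0
        (fun h => hR.zero_notMem (h ▸ hIm hc)) hK) (fun _ _ h => h) hc₀ h0
  have hne : Nonempty I := by
    by_contra hI
    rw [not_nonempty_iff] at hI
    exact hR.zero_notMem (Subsingleton.elim c₀ 0 ▸ hIm hc₀)
  have hfull : ∀ z : I → ℤ, (∀ i, 0 < z i) → (∀ i, A.mulVec z i ≤ 0) →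
      (rayRoots R z).Infinite := fun z hz hzK =>
    hR.infinite_rayRoots hA hS (fun i => (hz i).le)
      (fun h => (hz hne.some).ne' (congrFun h hne.some)) hzK (suppConnected_of_pos hInd hz)
  have hxinf := hfull x hx hxK
  have hxs : ∀ i, ∀ p q : ℤ, 0 < p → 0 < q → q ≤ p →
      (rayRoots R (p • x + q • simpleRefl A i x)).Infinite := by
    intro i p q hp hq hqp
    refine hfull _ (fun j => ?_) fun j => ?_
    · have h1 : 0 ≤ simpleRefl A i x j := by
        obtain rfl | hj := eq_or_ne j i
        · have := hxK j
          have := hx j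
          simp only [simpleRefl_apply, Pi.sub_apply, Pi.single_eq_same]
          omega
        · rw [simpleRefl_apply_of_ne hj]; exact (hx j).le
      exact add_pos_of_pos_of_nonneg (mul_pos hp (hx j)) (mul_nonneg hq.le h1)
    · rw [Matrix.mulVec_add, Matrix.mulVec_smul, Matrix.mulVec_smul]
      simp only [Pi.add_apply, Pi.smul_apply, smul_eq_mul, mulVec_simpleRefl]
      have h1 := hxK i
      have h2 := hxK j
      obtain rfl | hj := eq_or_ne j i
      · rw [hA.1]
        nlinarith
      · have h3 := mul_nonneg_of_nonpos_of_nonpos (hA.2.1 j i hj) h1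
        nlinarith
  have hxs' : ∀ i, ∀ p q : ℤ, 0 < p → 0 < q →
      (rayRoots R (p • x + q • simpleRefl A i x)).Infinite := by
    intro i p q hp hq
    obtain h | h := le_total q p
    · exact hxs i p q hp hq h
    · have := hR.infinite_rayRoots_simpleRefl hA (hxs i q p hq hp h) i
      rwa [map_add, map_smul, map_smul, simpleRefl_simpleRefl hA, add_comm] at this
  have hsign : ∀ c ∈ Im, 0 ≤ c → ∀ L : (I → ℤ) →+ (S → ℤ), IsGradingMap R L →
      (0 ≤ L c ↔ 0 ≤ L x) := fun c hc h0 =>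
    hR.imaginary_induction hA hIm hsingle hrefl
      (P := fun c => ∀ L : (I → ℤ) →+ (S → ℤ), IsGradingMap R L → (0 ≤ L c ↔ 0 ≤ L x))
      (fun c hc h0 hK L hL => hL.nonneg_iff_of_linked (hray c hc h0) hxinf fun p q hp hq =>
        hfull _ (fun i => add_pos_of_nonneg_of_pos (mul_nonneg hp.le (h0 i)) (mul_pos hq (hx i)))
          fun i => by
            rw [Matrix.mulVec_add, Matrix.mulVec_smul, Matrix.mulVec_smul]
            exact add_nonpos (mul_nonpos_of_nonneg_of_nonpos hp.le (hK i))
              (mul_nonpos_of_nonneg_of_nonpos hq.le (hxK i)))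
      (fun c i h L hL => (h _ (hL.comp_simpleRefl hR hA i)).trans
        (hL.nonneg_iff_of_linked hxinf (hR.infinite_rayRoots_simpleRefl hA hxinf i)
          (hxs' i)).symm) hc h0
  obtain h | h := hL.sign hxinf
  · exact Or.inl fun c hc h0 => (hsign c hc h0 L hL).2 h
  · refine Or.inr fun c hc h0 => (hL.sign (hray c hc h0)).resolve_left fun h' => ?_
    exact hL.ne_zero hxinf (le_antisymm h ((hsign c hc h0 L hL).1 h'))

end RootSets

end KMG

namespace KMG

/-! ### Finite gradations and restriction of roots -/

section RootBases

variable {S : Type*} [Fintype S] {V : Type*} [AddCommGroup V] [Module ℂ V]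

lemma exists_nat_of_nonneg (π : S → V) {c : S → ℤ} (hc : 0 ≤ c) :
    ∃ k : S → ℕ, ∑ s, (c s : ℂ) • π s = ∑ s, (k s : ℂ) • π s := by
  refine ⟨fun s => (c s).toNat, Finset.sum_congr rfl fun s _ => ?_⟩
  rw [← Int.cast_natCast, Int.toNat_of_nonneg (hc s)]

lemma IsRootBasis.neg {B : Matrix S S ℤ} {X : Set (Module.Dual ℂ V)}
    {π : S → Module.Dual ℂ V} {πv : S → V} (h : IsRootBasis B X π πv)
    (hX : ∀ s, -π s ∈ X) : IsRootBasis B X (-π) (-πv) := by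
  obtain ⟨h1, h2, h3, -, h5⟩ := h
  refine ⟨h1.neg, h2.neg, fun s t => by simp [h3], hX, fun χ hχ => ?_⟩
  refine (h5 χ hχ).symm.imp ?_ ?_
  · rintro ⟨c, rfl⟩
    exact ⟨c, by simp⟩
  · rintro ⟨c, rfl⟩
    exact ⟨c, by simp⟩

end RootBases

section RealRoots

variable {m : Type*} [LieRing m] [LieAlgebra ℂ m] {S : Type*} [Fintype S] [DecidableEq S]
  {B : Matrix S S ℤ}

/-- A real root is the only root on its ray. -/
lemma IsRealRoot.eq_of_proportional (hB : IsGCM B) (M : KacMoodyAlgebra B m)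
    {χ : Module.Dual ℂ M.H} (hχ : IsRealRoot M χ) : ∃ d : S → ℤ, χ = rootComb M d ∧
      ∀ r ∈ rootSet M, ∀ p q : ℤ, 0 < p → 0 < q → q • r = p • d → r = d := by
  have hR := isRootSet M hB
  induction hχ with
  | simple i =>
    refine ⟨Pi.single i 1, by simp, fun r hr p q hp hq h => ?_⟩
    have hj : ∀ j, q * r j = p * (Pi.single i 1 : S → ℤ) j := fun j => congrFun h j
    refine hR.eq_single i r hr (fun j => ?_) (fun j hji => ?_)
    · have h0 : (0 : S → ℤ) ≤ Pi.single i 1 := Pi.single_nonneg.2 zero_le_one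
      exact nonneg_of_mul_nonneg_right (hj j ▸ mul_nonneg hp.le (h0 j)) hq
    · have := hj j
      rw [Pi.single_eq_of_ne hji, mul_zero] at this
      exact (mul_eq_zero.1 this).resolve_left hq.ne'
  | reflect i χ _ ih =>
    obtain ⟨d, rfl, hd⟩ := ih
    refine ⟨simpleRefl B i d, (rootComb_simpleRefl M d i).symm, fun r hr p q hp hq h => ?_⟩
    rw [← hd (simpleRefl B i r) (hR.simpleRefl_mem i r hr) p q hp hq
      (by rw [← map_zsmul, h, map_zsmul, simpleRefl_simpleRefl hB]), simpleRefl_simpleRefl hB]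

lemma isRootBasis (hB : IsGCM B) (M : KacMoodyAlgebra B m) :
    IsRootBasis B (Delta M) M.root M.coroot := by
  refine ⟨M.indepRoot, M.indepCoroot, M.pairing, root_mem_Delta M, fun χ hχ => ?_⟩
  obtain ⟨c, rfl⟩ := exists_eq_rootComb M hχ
  refine ((isRootSet M hB).nonneg_or_nonpos c hχ).imp (fun h => ?_) (fun h => ?_)
  · exact exists_nat_of_nonneg M.root h
  · obtain ⟨k, hk⟩ := exists_nat_of_nonneg M.root (neg_nonneg.2 h)
    exact ⟨k, by rw [← hk, ← rootComb_apply, map_neg, neg_neg]⟩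

end RealRoots

section Restriction

variable {I : Type*} [Fintype I] [DecidableEq I] {A : Matrix I I ℤ}
  {g : Type*} [LieRing g] [LieAlgebra ℂ g]
  {S : Type*} [Fintype S] [DecidableEq S] {B : Matrix S S ℤ}
  {m : Type*} [LieRing m] [LieAlgebra ℂ m]

lemma wtSpaceι_le_resD (G : KacMoodyAlgebra A g) (M : KacMoodyAlgebra B m) (φ : m →ₗ⁅ℂ⁆ g)
    (hle : M.H.map φ.toLinearMap ≤ G.H) (χ : Module.Dual ℂ G.H) :
    wtSpaceι G.H.subtype χ ≤
      wtSpaceι (φ.toLinearMap ∘ₗ M.H.subtype) (resD G M φ hle χ) :=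
  fun _ hx v => hx (cartanIncl G M φ hle v)

lemma resD_mem (G : KacMoodyAlgebra A g) (M : KacMoodyAlgebra B m) (φ : m →ₗ⁅ℂ⁆ g)
    (hgr : IsFinGrading M φ) (hle : M.H.map φ.toLinearMap ≤ G.H) {χ : Module.Dual ℂ G.H}
    (hχ : χ ∈ Delta G) : resD G M φ hle χ ∈ insert 0 (Delta M) := by
  obtain ⟨x, hx, hx0⟩ := (Submodule.ne_bot_iff _).1 hχ.2
  refine mem_of_mem_wtSpaceι (fun v w => ?_) (wtSpaceι_le_resD G M φ hle χ hx) hx0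
    (hgr.2.1 ▸ Submodule.mem_top)
  exact (LieHom.map_lie φ _ _).symm.trans (by
    rw [show ⁅M.H.subtype v, M.H.subtype w⁆ = 0 from M.abelian v w, map_zero])

lemma exists_restriction (G : KacMoodyAlgebra A g) (M : KacMoodyAlgebra B m) (φ : m →ₗ⁅ℂ⁆ g)
    (hgr : IsFinGrading M φ) (hle : M.H.map φ.toLinearMap ≤ G.H) :
    ∃ L : (I → ℤ) →+ (S → ℤ), ∀ c, resD G M φ hle (rootComb G c) = rootComb M (L c) := by
  have hz : ∀ i, ∃ z, resD G M φ hle (G.root i) = rootComb M z := fun i => by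
    obtain h | h := resD_mem G M φ hgr hle (root_mem_Delta G i)
    · exact ⟨0, by rw [h, map_zero]⟩
    · exact exists_eq_rootComb M h
  choose z hz using hz
  refine ⟨(Fintype.linearCombination ℤ z).toAddMonoidHom, fun c => ?_⟩
  have h : resD G M φ hle (rootComb G c) = ∑ i, c i • resD G M φ hle (G.root i) := by
    ext v
    simp [resD, rootComb_apply, LinearMap.sum_apply]
  rw [h]
  change _ = rootComb M (Fintype.linearCombination ℤ z c)
  simp only [hz, Fintype.linearCombination_apply, map_sum, map_zsmul]

lemma finite_fiber (G : KacMoodyAlgebra A g) (M : KacMoodyAlgebra B m) (φ : m →ₗ⁅ℂ⁆ g)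
    (hgr : IsFinGrading M φ) (hle : M.H.map φ.toLinearMap ≤ G.H) (γ : Module.Dual ℂ M.H) :
    {χ ∈ Delta G | resD G M φ hle χ = γ}.Finite := by
  by_cases hγ : γ ∈ insert 0 (Delta M)
  swap
  · exact Set.Finite.subset Set.finite_empty fun χ hχ =>
      hγ (hχ.2 ▸ resD_mem G M φ hgr hle hχ.1)
  have hfin := hgr.2.2 γ hγ
  set V := wtSpaceι (φ.toLinearMap ∘ₗ M.H.subtype) γ
  choose x hx hx0 using fun χ : {χ ∈ Delta G | resD G M φ hle χ = γ} =>
    (Submodule.ne_bot_iff _).1 χ.2.1.2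
  have hV : ∀ χ, x χ ∈ V := fun χ => by
    have h := wtSpaceι_le_resD G M φ hle χ.1 (hx χ)
    rwa [χ.2.2] at h
  have hind : LinearIndependent ℂ x :=
    ((iSupIndep_wtSpaceι (ι := G.H.subtype) G.abelian).comp
      Subtype.val_injective).linearIndependent _ hx hx0
  have hindV : LinearIndependent ℂ fun χ => (⟨x χ, hV χ⟩ : V) :=
    LinearIndependent.of_comp V.subtype hind
  exact Set.finite_coe_iff.1 hindV.finite

lemma isGradingMap (hB : IsGCM B) (G : KacMoodyAlgebra A g) (M : KacMoodyAlgebra B m)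
    (φ : m →ₗ⁅ℂ⁆ g) (hgr : IsFinGrading M φ) (hle : M.H.map φ.toLinearMap ≤ G.H)
    {L : (I → ℤ) →+ (S → ℤ)} (hL : ∀ c, resD G M φ hle (rootComb G c) = rootComb M (L c)) :
    (∀ c ∈ rootSet G, L c ≠ 0 → L c ∈ rootSet M) ∧ IsGradingMap (rootSet G) L := by
  have hmem : ∀ c ∈ rootSet G, L c ≠ 0 → L c ∈ rootSet M := fun c hc h0 => by
    have h := resD_mem G M φ hgr hle hc
    rw [hL] at h
    exact h.resolve_left fun h => h0 (rootComb_injective M (h.trans (map_zero _).symm))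
  refine ⟨hmem, fun c hc => ?_, fun y => ?_⟩
  · by_cases h0 : L c = 0
    · exact Or.inl h0.ge
    · exact (isRootSet M hB).nonneg_or_nonpos _ (hmem c hc h0)
  · refine ((finite_fiber G M φ hgr hle (rootComb M y)).preimage
      (rootComb_injective G).injOn).subset ?_
    rintro c ⟨hc, rfl⟩
    exact ⟨hc, hL c⟩

/-- The imaginary roots, in coordinates with respect to the simple roots. -/
def imagSet (G : KacMoodyAlgebra A g) : Set (I → ℤ) :=
  {c ∈ rootSet G | ¬ IsRealRoot G (rootComb G c)}

lemma single_notMem_imagSet (G : KacMoodyAlgebra A g) (i : I) : Pi.single i 1 ∉ imagSet G :=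
  fun h => h.2 (by simpa using IsRealRoot.simple i)

lemma simpleRefl_mem_imagSet (hA : IsGCM A) (G : KacMoodyAlgebra A g) (i : I) {c : I → ℤ}
    (hc : c ∈ imagSet G) : simpleRefl A i c ∈ imagSet G := by
  refine ⟨(isRootSet G hA).simpleRefl_mem i c hc.1, fun h => hc.2 ?_⟩
  have := h.reflect i
  rwa [← rootComb_simpleRefl, simpleRefl_simpleRefl hA] at this

/-- The restriction of an imaginary root is an imaginary root. -/
lemma restriction_imaginary (hB : IsGCM B) (G : KacMoodyAlgebra A g) (M : KacMoodyAlgebra B m)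
    {L : (I → ℤ) →+ (S → ℤ)} (hmem : ∀ c ∈ rootSet G, L c ≠ 0 → L c ∈ rootSet M)
    (hL : IsGradingMap (rootSet G) L) {c : I → ℤ} (hc : (rayRoots (rootSet G) c).Infinite) :
    ¬ IsRealRoot M (rootComb M (L c)) := by
  intro hreal
  obtain ⟨d, hd, huniq⟩ := hreal.eq_of_proportional hB M
  obtain rfl := rootComb_injective M hd
  refine hc ((hL.finite_fiber (L c)).subset ?_)
  rintro r ⟨hr, p, q, hp, hq, hpq⟩
  have h1 : q • L r = p • L c := by rw [← map_zsmul, hpq, map_zsmul]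
  have h0 : L r ≠ 0 := fun h => by
    rw [h, smul_zero] at h1
    exact hL.ne_zero hc ((smul_eq_zero.1 h1.symm).resolve_left hp.ne')
  exact ⟨hr, huniq _ (hmem r hr h0) p q hp hq h1⟩

/-- Up to replacing the root basis of the grading subalgebra by its opposite, the restrictions of
the positive imaginary roots are positive imaginary roots. -/
theorem exists_isRootBasis_restriction (hA : IsGCM A) (hInd : Indecomposable A)
    (hS : Symmetrizable A) (hB : IsGCM B) (G : KacMoodyAlgebra A g) (M : KacMoodyAlgebra B m)
    (φ : m →ₗ⁅ℂ⁆ g) (hgr : IsFinGrading M φ) (hle : M.H.map φ.toLinearMap ≤ G.H) :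
    ∃ (π : S → Module.Dual ℂ M.H) (πv : S → M.H), IsRootBasis B (Delta M) π πv ∧
      ∀ χ ∈ posRoots G, ¬ IsRealRoot G χ →
        resD G M φ hle χ ∈ Delta M ∧ ¬ IsRealRoot M (resD G M φ hle χ) ∧
        ∃ c : S → ℕ, resD G M φ hle χ = ∑ s, (c s : ℂ) • π s := by
  obtain ⟨L, hL⟩ := exists_restriction G M φ hgr hle
  obtain ⟨hmem, hgm⟩ := isGradingMap hB G M φ hgr hle hL
  obtain ⟨hray, hsign⟩ := (isRootSet G hA).imaginary_sign hA hInd hS (Im := imagSet G)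
    (fun c hc => hc.1) (single_notMem_imagSet G) (fun i c => simpleRefl_mem_imagSet hA G i) hgm
  have key : ∀ π : S → Module.Dual ℂ M.H,
      (∀ c ∈ imagSet G, 0 ≤ c → ∃ k : S → ℕ, rootComb M (L c) = ∑ s, (k s : ℂ) • π s) →
      ∀ χ ∈ posRoots G, ¬ IsRealRoot G χ →
        resD G M φ hle χ ∈ Delta M ∧ ¬ IsRealRoot M (resD G M φ hle χ) ∧
        ∃ c : S → ℕ, resD G M φ hle χ = ∑ s, (c s : ℂ) • π s := by
    rintro π hπ χ ⟨hχ, k, hk⟩ hre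
    obtain ⟨c, hc0, rfl⟩ : ∃ c : I → ℤ, 0 ≤ c ∧ χ = rootComb G c :=
      ⟨fun i => k i, fun i => Int.natCast_nonneg _, by simpa [rootComb_apply] using hk⟩
    have hc : c ∈ imagSet G := ⟨hχ, hre⟩
    rw [hL]
    exact ⟨hmem c hχ (hgm.ne_zero (hray c hc hc0)),
      restriction_imaginary hB G M hmem hgm (hray c hc hc0), hπ c hc hc0⟩
  obtain h | h := hsign
  · exact ⟨M.root, M.coroot, isRootBasis hB M,
      key _ fun c hc hc0 => exists_nat_of_nonneg M.root (h c hc hc0)⟩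
  · refine ⟨-M.root, -M.coroot, (isRootBasis hB M).neg (neg_root_mem_Delta M),
      key _ fun c hc hc0 => ?_⟩
    obtain ⟨k, hk⟩ := exists_nat_of_nonneg M.root (neg_nonneg.2 (h c hc hc0))
    rw [← rootComb_apply, map_neg] at hk
    exact ⟨k, by simp only [Pi.neg_apply, smul_neg, Finset.sum_neg_distrib, ← hk, neg_neg]⟩

end Restriction

end KMG


open KMG

section Statement

attribute [local instance] Classical.propDecidable

variable {I : Type*} [Fintype I] [DecidableEq I] {A : Matrix I I ℤ}
variable {g : Type*} [LieRing g] [LieAlgebra ℂ g]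
variable {S : Type*} [Fintype S] [DecidableEq S] {B : Matrix S S ℤ}
variable {m : Type*} [LieRing m] [LieAlgebra ℂ m]

theorem statement6
    (hGCM : IsGCM A) (hInd : Indecomposable A) (hSym : Symmetrizable A)
    (G : KacMoodyAlgebra A g)
    (hBgcm : IsGCM B) (hBind : Indecomposable B)
    (M : KacMoodyAlgebra B m) (φ : m →ₗ⁅ℂ⁆ g)
    (hgr : IsFinGrading M φ) (hle : M.H.map φ.toLinearMap ≤ G.H)
    (hIm : ∃ χ ∈ Delta G, ¬ IsRealRoot G χ) :
    ∃ (π : S → Module.Dual ℂ ↥M.H) (πv : S → ↥M.H),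
      IsRootBasis B (Delta M) π πv ∧
      ∀ χ ∈ posRoots G, ¬ IsRealRoot G χ →
        resD G M φ hle χ ∈ Delta M ∧ ¬ IsRealRoot M (resD G M φ hle χ) ∧
        ∃ c : S → ℕ, resD G M φ hle χ = ∑ s, (c s : ℂ) • π s :=
  exists_isRootBasis_restriction hGCM hInd hSym hBgcm G M φ hgr hle

end Statement
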